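/- arXiv:2602.22281 — 4 statements merged into one kernel-verified Lean document; each statement's English description precedes it below -/
import Mathlib

section
/- Let 𝒯 be a set of (rooted or unrooted) binary phylogenetic trees on a finite taxon set X and let F be an agreement forest for 𝒯. If X' ⊆ X, then F' = { B ∩ X' : B ∈ F, B ∩ X' ≠ ∅ } is an agreement forest for 𝒯' = { T|X' : T ∈ 𝒯 }, and |F'| ≤ |F|. -/
/-- An unrooted binary phylogenetic tree on taxon set `X`: a finite tree in which
every internal vertex has degree 3 and the leaves (degree-1 vertices) are
bijectively labelled by `X`. -/
structure UTree (X : Type) : Type 1 where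
  V : Type
  finV : Finite V
  g : SimpleGraph V
  isTree : g.IsTree
  label : X → V
  label_inj : Function.Injective label
  leaf_iff : ∀ v : V, (g.neighborSet v).ncard = 1 ↔ v ∈ Set.range label
  internal_deg : ∀ v : V, v ∉ Set.range label → (g.neighborSet v).ncard = 3

namespace UTree

variable {X : Type}

/-- Vertex set of the minimal subtree `T[B]` of `T` spanning the leaves labelled by `B`:
the vertices lying on a path between two leaves labelled by elements of `B`. -/
def spanSet (T : UTree X) (B : Set X) : Set T.V :=
  {v | ∃ x ∈ B, ∃ y ∈ B, ∃ p : T.g.Walk (T.label x) (T.label y), p.IsPath ∧ v ∈ p.support}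

/-- `deg^T(B)`: the number of edges of `T` with exactly one endpoint in `T[B]`. -/
noncomputable def blockDeg (T : UTree X) (B : Set X) : ℕ :=
  {e : Sym2 T.V | ∃ u v : T.V, T.g.Adj u v ∧ e = s(u, v) ∧
    u ∈ T.spanSet B ∧ v ∉ T.spanSet B}.ncard

/-- The vertices of `T[B]` surviving the suppression of degree-2 vertices:
the leaves labelled by `B` together with the branch points of `T[B]`. -/
def keepSet (T : UTree X) (B : Set X) : Set T.V :=
  {v | v ∈ T.spanSet B ∧
    (v ∈ T.label '' B ∨ 3 ≤ (T.g.neighborSet v ∩ T.spanSet B).ncard)}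

/-- Adjacency in the suppressed tree `T|B`: two surviving vertices joined by a path of
`T[B]` containing no other surviving vertex internally. -/
def restAdj (T : UTree X) (B : Set X) (u v : T.V) : Prop :=
  u ∈ T.keepSet B ∧ v ∈ T.keepSet B ∧ u ≠ v ∧
    ∃ p : T.g.Walk u v, p.IsPath ∧ (∀ w ∈ p.support, w ∈ T.spanSet B) ∧
      ∀ w ∈ p.support, w ∈ T.keepSet B → w = u ∨ w = v

/-- `T|B = T'|B`: a leaf-label-preserving isomorphism between the suppressed trees. -/
def restEq (T T' : UTree X) (B : Set X) : Prop :=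
  ∃ φ : T.V → T'.V, Set.BijOn φ (T.keepSet B) (T'.keepSet B) ∧
    (∀ x ∈ B, φ (T.label x) = T'.label x) ∧
    ∀ u v : T.V, u ∈ T.keepSet B → v ∈ T.keepSet B →
      (T.restAdj B u v ↔ T'.restAdj B (φ u) (φ v))

/-- `F` is a partition of `X` into nonempty blocks. -/
def IsForestPartition (F : Set (Set X)) : Prop :=
  (∀ B ∈ F, B.Nonempty) ∧ ∀ x : X, ∃! B, B ∈ F ∧ x ∈ B

/-- An unrooted agreement forest for `𝒯`: a partition of `X` whose blocks have a common
topology in all trees and induce pairwise vertex-disjoint subtrees in each tree. -/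
def IsAgreementForest (𝒯 : Set (UTree X)) (F : Set (Set X)) : Prop :=
  IsForestPartition F ∧
  (∀ B ∈ F, ∀ T ∈ 𝒯, ∀ T' ∈ 𝒯, restEq T T' B) ∧
  ∀ B ∈ F, ∀ B' ∈ F, B ≠ B' → ∀ T ∈ 𝒯, Disjoint (T.spanSet B) (T.spanSet B')

/-- `(x 0, …, x (m-1))` is a chain in `T`: the parent of each `x i` is equal to or
adjacent to the parent of `x (i+1)` (parents being the unique neighbours of the leaves). -/
def IsChainIn (T : UTree X) {m : ℕ} (x : Fin m → X) : Prop :=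
  ∀ (i : ℕ) (h1 : i + 1 < m), ∀ p q : T.V,
    T.g.Adj (T.label (x ⟨i, Nat.lt_of_succ_lt h1⟩)) p →
    T.g.Adj (T.label (x ⟨i + 1, h1⟩)) q → p = q ∨ T.g.Adj p q

/-- A common `m`-chain of `𝒯`: a sequence of `m ≥ 2` distinct taxa that is a chain in
every tree of `𝒯`. -/
def IsCommonChain (𝒯 : Set (UTree X)) {m : ℕ} (x : Fin m → X) : Prop :=
  2 ≤ m ∧ Function.Injective x ∧ ∀ T ∈ 𝒯, T.IsChainIn x

/-- `T[S]` is pendant in `T`: deleting some edge splits `T` into two subtrees, one of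
which contains exactly the leaves labelled by `S`. -/
def IsPendant (T : UTree X) (S : Set X) : Prop :=
  ∃ u v : T.V, T.g.Adj u v ∧
    ∀ x : X, (T.g.deleteEdges {s(u, v)}).Reachable u (T.label x) ↔ x ∈ S

/-- `u` is an attachment point of `T[S]`: a vertex of `T[S]` adjacent to a vertex
outside `T[S]`. -/
def attachPoint (T : UTree X) (S : Set X) (u : T.V) : Prop :=
  u ∈ T.spanSet S ∧ ∃ w : T.V, w ∉ T.spanSet S ∧ T.g.Adj u w

/-- A label-preserving isomorphism between `T[S]` and `T'[S]` respecting the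
attachment points. -/
def pendantIso (T T' : UTree X) (S : Set X) : Prop :=
  ∃ φ : T.V → T'.V, Set.BijOn φ (T.spanSet S) (T'.spanSet S) ∧
    (∀ x ∈ S, φ (T.label x) = T'.label x) ∧
    (∀ u v : T.V, u ∈ T.spanSet S → v ∈ T.spanSet S →
      (T.g.Adj u v ↔ T'.g.Adj (φ u) (φ v))) ∧
    ∀ u : T.V, attachPoint T S u → attachPoint T' S (φ u)

/-- `S` induces a common pendant subtree of `𝒯`. -/
def InducesCommonPendant (𝒯 : Set (UTree X)) (S : Set X) : Prop :=
  S.Nonempty ∧ (∀ T ∈ 𝒯, IsPendant T S) ∧ ∀ T ∈ 𝒯, ∀ T' ∈ 𝒯, pendantIso T T' S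

/-- `T'` is (isomorphic to) the restriction `T|X'` of `T` to the taxa in `X'`. -/
def IsRestrictionOf (T : UTree X) (X' : Set X) (T' : UTree X') : Prop :=
  ∃ φ : T'.V → T.V, Function.Injective φ ∧
    (∀ x : X', φ (T'.label x) = T.label x.val) ∧
    Set.range φ = T.keepSet X' ∧
    ∀ u v : T'.V, T'.g.Adj u v ↔ T.restAdj X' (φ u) (φ v)

/-- `𝒯' = { T|X' : T ∈ 𝒯 }` up to label-preserving isomorphism. -/
def IsRestrictionFamily (𝒯 : Set (UTree X)) (X' : Set X) (𝒯' : Set (UTree X')) : Prop :=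
  (∀ T' ∈ 𝒯', ∃ T ∈ 𝒯, IsRestrictionOf T X' T') ∧
  ∀ T ∈ 𝒯, ∃ T' ∈ 𝒯', IsRestrictionOf T X' T'

/-- The subtree reduction rule is applicable: some `S` with `|S| ≥ 2` induces a common
pendant subtree. -/
def SubtreeRuleApplicable (𝒯 : Set (UTree X)) : Prop :=
  ∃ S : Set X, 2 ≤ S.ncard ∧ InducesCommonPendant 𝒯 S

/-- The chain reduction rule (with truncation length `r`) is applicable: `𝒯` has a
common `m`-chain with `m > r`. -/
def ChainRuleApplicable (𝒯 : Set (UTree X)) (r : ℕ) : Prop :=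
  ∃ (m : ℕ) (x : Fin m → X), r < m ∧ IsCommonChain 𝒯 x

end UTree

/-- A rooted binary phylogenetic tree on taxon set `X`: a finite directed tree with all
edges directed away from the root, whose root has in-degree 0 (and out-degree 2 unless
it is itself the unique leaf), whose leaves (out-degree 0) are bijectively labelled by
`X`, and whose remaining vertices have in-degree 1 and out-degree 2. -/
structure RTree (X : Type) : Type 1 where
  V : Type
  finV : Finite V
  E : V → V → Prop
  root : V
  label : X → V
  label_inj : Function.Injective label
  reach_root : ∀ v : V, Relation.ReflTransGen E root v
  not_into_root : ∀ u : V, ¬ E u root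
  leaf_iff : ∀ v : V, {w : V | E v w} = ∅ ↔ v ∈ Set.range label
  out_two : ∀ v : V, v ∉ Set.range label → {w : V | E v w}.ncard = 2
  in_one : ∀ v : V, v ≠ root → {u : V | E u v}.ncard = 1

namespace RTree

variable {X : Type}

/-- `u` is an ancestor of (or equal to) `v`. -/
def anc (T : RTree X) (u v : T.V) : Prop := Relation.ReflTransGen T.E u v

/-- Vertex set of the minimal subtree `T[B]` of `T` spanning the leaves labelled by `B`:
the vertices that are ancestors of some leaf in `B` and descendants of every common
ancestor of all leaves in `B`. -/
def spanSet (T : RTree X) (B : Set X) : Set T.V :=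
  {v | (∃ x ∈ B, T.anc v (T.label x)) ∧
    ∀ w : T.V, (∀ x ∈ B, T.anc w (T.label x)) → T.anc w v}

/-- `deg^T(B)`: the number of edges of `T` with exactly one endpoint in `T[B]`. -/
noncomputable def blockDeg (T : RTree X) (B : Set X) : ℕ :=
  {p : T.V × T.V | T.E p.1 p.2 ∧
    Xor' (p.1 ∈ T.spanSet B) (p.2 ∈ T.spanSet B)}.ncard

/-- The vertices of `T[B]` surviving the suppression of in-degree-1 out-degree-1
vertices: the leaves labelled by `B` together with the branch points of `T[B]`. -/
def keepSet (T : RTree X) (B : Set X) : Set T.V :=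
  {v | v ∈ T.spanSet B ∧
    (v ∈ T.label '' B ∨ 2 ≤ ({w : T.V | T.E v w} ∩ T.spanSet B).ncard)}

/-- Adjacency in the suppressed tree `T|B`: `v` is reachable from `u` by a directed path
inside `T[B]` containing no other surviving vertex internally. -/
def restAdj (T : RTree X) (B : Set X) (u v : T.V) : Prop :=
  u ∈ T.keepSet B ∧ v ∈ T.keepSet B ∧ u ≠ v ∧
    Relation.ReflTransGen
      (fun a b => T.E a b ∧ b ∈ T.spanSet B ∧ (b = v ∨ b ∉ T.keepSet B)) u v

/-- `T|B = T'|B`: a leaf-label-preserving isomorphism between the suppressed trees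
respecting edge directions. -/
def restEq (T T' : RTree X) (B : Set X) : Prop :=
  ∃ φ : T.V → T'.V, Set.BijOn φ (T.keepSet B) (T'.keepSet B) ∧
    (∀ x ∈ B, φ (T.label x) = T'.label x) ∧
    ∀ u v : T.V, u ∈ T.keepSet B → v ∈ T.keepSet B →
      (T.restAdj B u v ↔ T'.restAdj B (φ u) (φ v))

/-- `F` is a partition of `X` into nonempty blocks. -/
def IsForestPartition (F : Set (Set X)) : Prop :=
  (∀ B ∈ F, B.Nonempty) ∧ ∀ x : X, ∃! B, B ∈ F ∧ x ∈ B

/-- A rooted agreement forest for `𝒯`: a partition of `X` whose blocks have a common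
topology in all trees and induce pairwise vertex-disjoint subtrees in each tree. -/
def IsAgreementForest (𝒯 : Set (RTree X)) (F : Set (Set X)) : Prop :=
  IsForestPartition F ∧
  (∀ B ∈ F, ∀ T ∈ 𝒯, ∀ T' ∈ 𝒯, restEq T T' B) ∧
  ∀ B ∈ F, ∀ B' ∈ F, B ≠ B' → ∀ T ∈ 𝒯, Disjoint (T.spanSet B) (T.spanSet B')

/-- `(x 0, …, x (m-1))` is a chain in the rooted tree `T`, with `x 0` closest to the
root: the parent of each `x i` is equal to, or the parent of, the parent of `x (i+1)`. -/
def IsChainIn (T : RTree X) {m : ℕ} (x : Fin m → X) : Prop :=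
  ∀ (i : ℕ) (h1 : i + 1 < m), ∀ p q : T.V,
    T.E p (T.label (x ⟨i, Nat.lt_of_succ_lt h1⟩)) →
    T.E q (T.label (x ⟨i + 1, h1⟩)) → p = q ∨ T.E p q

/-- A common `m`-chain of `𝒯`: a sequence of `m ≥ 2` distinct taxa that is a chain in
every tree of `𝒯`. -/
def IsCommonChain (𝒯 : Set (RTree X)) {m : ℕ} (x : Fin m → X) : Prop :=
  2 ≤ m ∧ Function.Injective x ∧ ∀ T ∈ 𝒯, T.IsChainIn x

/-- `T[S]` is pendant in `T`: there is an edge `(u,v)` such that the leaves below `v`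
are exactly those labelled by `S`. -/
def IsPendant (T : RTree X) (S : Set X) : Prop :=
  ∃ u v : T.V, T.E u v ∧ ∀ x : X, (T.anc v (T.label x) ↔ x ∈ S)

/-- A label-preserving isomorphism between `T[S]` and `T'[S]` respecting directions. -/
def pendantIso (T T' : RTree X) (S : Set X) : Prop :=
  ∃ φ : T.V → T'.V, Set.BijOn φ (T.spanSet S) (T'.spanSet S) ∧
    (∀ x ∈ S, φ (T.label x) = T'.label x) ∧
    ∀ u v : T.V, u ∈ T.spanSet S → v ∈ T.spanSet S →
      (T.E u v ↔ T'.E (φ u) (φ v))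

/-- `S` induces a common pendant subtree of `𝒯`. -/
def InducesCommonPendant (𝒯 : Set (RTree X)) (S : Set X) : Prop :=
  S.Nonempty ∧ (∀ T ∈ 𝒯, IsPendant T S) ∧ ∀ T ∈ 𝒯, ∀ T' ∈ 𝒯, pendantIso T T' S

/-- `T'` is (isomorphic to) the restriction `T|X'` of `T` to the taxa in `X'`. -/
def IsRestrictionOf (T : RTree X) (X' : Set X) (T' : RTree X') : Prop :=
  ∃ φ : T'.V → T.V, Function.Injective φ ∧
    (∀ x : X', φ (T'.label x) = T.label x.val) ∧
    Set.range φ = T.keepSet X' ∧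
    ∀ u v : T'.V, T'.E u v ↔ T.restAdj X' (φ u) (φ v)

/-- `𝒯' = { T|X' : T ∈ 𝒯 }` up to label-preserving isomorphism. -/
def IsRestrictionFamily (𝒯 : Set (RTree X)) (X' : Set X) (𝒯' : Set (RTree X')) : Prop :=
  (∀ T' ∈ 𝒯', ∃ T ∈ 𝒯, IsRestrictionOf T X' T') ∧
  ∀ T ∈ 𝒯, ∃ T' ∈ 𝒯', IsRestrictionOf T X' T'

/-- The subtree reduction rule is applicable: some `S` with `|S| ≥ 2` induces a common
pendant subtree. -/
def SubtreeRuleApplicable (𝒯 : Set (RTree X)) : Prop :=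
  ∃ S : Set X, 2 ≤ S.ncard ∧ InducesCommonPendant 𝒯 S

/-- The chain reduction rule (with truncation length `r`) is applicable: `𝒯` has a
common `m`-chain with `m > r`. -/
def ChainRuleApplicable (𝒯 : Set (RTree X)) (r : ℕ) : Prop :=
  ∃ (m : ℕ) (x : Fin m → X), r < m ∧ IsCommonChain 𝒯 x

end RTree


namespace PhyloAux

/-- `w` separates `u` from `v`: every walk from `u` to `v` passes through `w`. -/
def Sep {V : Type} (g : SimpleGraph V) (u w v : V) : Prop := ∀ p : g.Walk u v, w ∈ p.support

section sep
variable {V : Type} {g : SimpleGraph V}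

theorem Sep.symm {u w v : V} (h : Sep g u w v) : Sep g v w u := by
  intro p
  have := h p.reverse
  simpa using this

theorem Sep.left (u v : V) : Sep g u u v := fun p => p.start_mem_support

theorem Sep.right (u v : V) : Sep g u v v := fun p => p.end_mem_support

theorem Sep.split {u w v : V} (h : Sep g u w v) (z : V) : Sep g u w z ∨ Sep g z w v := by
  by_contra hc
  simp only [Sep, not_or, not_forall] at hc
  obtain ⟨⟨p, hp⟩, ⟨q, hq⟩⟩ := hc
  have := h (p.append q)
  rw [SimpleGraph.Walk.mem_support_append_iff] at this
  tauto

theorem Sep.self {u w : V} (h : Sep g u w u) : w = u := by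
  have := h SimpleGraph.Walk.nil
  simpa using this

theorem Sep.adj {u w v : V} (h : Sep g u w v) (a : g.Adj u v) : w = u ∨ w = v := by
  have := h (SimpleGraph.Walk.cons a SimpleGraph.Walk.nil)
  simpa using this

theorem Sep.antisymm (hg : g.Connected) {u w v : V} (h : Sep g u w v) (h' : Sep g u v w) :
    w = v := by
  classical
  obtain ⟨p, hp⟩ := hg.exists_isPath u v
  have hw := h p
  by_contra hne
  have := h' (p.takeUntil w hw)
  exact SimpleGraph.Walk.endpoint_notMem_support_takeUntil hp hw (Ne.symm hne) this

theorem Sep.trans {u x w v : V} (h : Sep g u x w) (h' : Sep g u w v) : Sep g u x v := by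
  classical
  intro p
  exact p.support_takeUntil_subset_support (h' p) (h _)

theorem Sep.trans' (hg : g.Connected) {u x w v : V} (h : Sep g u x w) (h' : Sep g u w v) :
    Sep g x w v := by
  rcases h'.split x with h1 | h1
  · have := h.antisymm hg h1
    subst this
    exact Sep.left _ _
  · exact h1

theorem Sep.edge (hg : g.IsAcyclic) {x y : V} (a : g.Adj x y) (z : V) :
    Sep g x y z ∨ Sep g y x z := by
  classical
  by_contra hc
  simp only [Sep, not_or, not_forall] at hc
  obtain ⟨⟨p, hp⟩, ⟨q, hq⟩⟩ := hc
  rw [SimpleGraph.isAcyclic_iff_forall_adj_isBridge] at hg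
  have hb := hg a
  rw [SimpleGraph.isBridge_iff_forall_walk_mem_edges] at hb
  have := hb (p.append q.reverse)
  rw [SimpleGraph.Walk.edges_append] at this
  simp only [SimpleGraph.Walk.edges_reverse, List.mem_append, List.mem_reverse] at this
  rcases this with h | h
  · exact hp (p.snd_mem_support_of_mem_edges h)
  · exact hq (q.fst_mem_support_of_mem_edges h)

theorem Sep.step (hg : g.IsTree) {v x : V} (h : v ≠ x) : ∃ n, g.Adj v n ∧ Sep g v n x := by
  obtain ⟨p, hp⟩ := hg.1.exists_isPath v x
  cases p with
  | nil => exact absurd rfl h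
  | @cons _ n _ a q =>
    refine ⟨n, a, ?_⟩
    rcases Sep.edge hg.2 a x with h1 | h1
    · exact h1
    · rw [SimpleGraph.Walk.cons_isPath_iff] at hp
      exact absurd (h1 q) hp.2

theorem sep_iff (hg : g.IsTree) {u w v : V} :
    (∃ p : g.Walk u v, p.IsPath ∧ w ∈ p.support) ↔ Sep g u w v := by
  classical
  constructor
  · rintro ⟨p, hp, hw⟩ q
    have : p = q.bypass := (hg.existsUnique_path u v).unique hp q.bypass_isPath
    rw [this] at hw
    exact q.support_bypass_subset_support hw
  · intro h
    obtain ⟨p, hp⟩ := hg.1.exists_isPath u v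
    exact ⟨p, hp, h p⟩

theorem Sep.push {v w u a b : V} (h : Sep g v w u) (h' : Sep g a u b) :
    Sep g v w a ∨ Sep g v w b := by
  rcases h'.split v with h1 | h1
  · exact Or.inl (h.trans h1.symm)
  · exact Or.inr (h.trans h1)

/-- adjacency obtained from the separation relation on the set `K` -/
def SAdj (g : SimpleGraph V) (K : Set V) (u v : V) : Prop :=
  u ∈ K ∧ v ∈ K ∧ u ≠ v ∧ ∀ w ∈ K, Sep g u w v → w = u ∨ w = v

theorem sadj_chain [Finite V] (hg : g.Connected) (K : Set V) {w : V} (n : ℕ) :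
    ∀ {u v : V}, {y | Sep g u y v}.ncard ≤ n → u ∈ K → v ∈ K → ¬ Sep g u w v →
      Relation.ReflTransGen (fun a b => SAdj g K a b ∧ b ≠ w) u v := by
  induction n with
  | zero =>
    intro u v h
    have : {y | Sep g u y v} = ∅ := by
      rw [← Set.ncard_eq_zero (Set.toFinite _)]; omega
    have h2 : u ∈ {y | Sep g u y v} := Sep.left _ _
    rw [this] at h2
    exact absurd h2 (by simp)
  | succ n ih =>
    intro u v hn hu hv hs
    by_cases huv : u = v
    · subst huv; exact .refl
    by_cases hA : SAdj g K u v
    · refine .single ⟨hA, ?_⟩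
      rintro rfl
      exact hs (Sep.right _ _)
    · have : ∃ x ∈ K, Sep g u x v ∧ x ≠ u ∧ x ≠ v := by
        by_contra hc
        push Not at hc
        refine hA ⟨hu, hv, huv, fun x hx hsx => ?_⟩
        by_contra h3
        push Not at h3
        exact h3.2 (hc x hx hsx h3.1)
      obtain ⟨x, hx, hsx, hxu, hxv⟩ := this
      have l1 : {y | Sep g u y x}.ncard < {y | Sep g u y v}.ncard := by
        refine Set.ncard_lt_ncard ⟨fun y hy => Sep.trans hy hsx, fun hsub => ?_⟩ (Set.toFinite _)
        have h4 : Sep g u v x := hsub (Sep.right u v)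
        exact hxv (hsx.antisymm hg h4)
      have l2 : {y | Sep g x y v}.ncard < {y | Sep g u y v}.ncard := by
        refine Set.ncard_lt_ncard
          ⟨fun y hy => (Sep.trans (Sep.symm hy) hsx.symm).symm, fun hsub => ?_⟩ (Set.toFinite _)
        have h4 : Sep g x u v := hsub (Sep.left u v)
        exact hxu (hsx.symm.antisymm hg h4.symm)
      refine (ih (by omega) hu hx fun h => hs (h.trans hsx)).trans
        (ih (by omega) hx hv fun h => hs (Sep.trans h.symm hsx.symm).symm)

theorem not_sep_iff [Finite V] (hg : g.Connected) {K : Set V} {u w v : V}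
    (hu : u ∈ K) (hw : w ∈ K) (hv : v ∈ K) :
    ¬ Sep g u w v ↔
      u ≠ w ∧ Relation.ReflTransGen (fun a b => SAdj g K a b ∧ b ≠ w) u v := by
  constructor
  · intro h
    refine ⟨?_, sadj_chain hg K _ le_rfl hu hv h⟩
    rintro rfl
    exact h (Sep.left _ _)
  · rintro ⟨hne, h⟩
    clear hv
    induction h with
    | refl => exact fun h => hne h.self.symm
    | @tail a b _ hab ih =>
      intro hs
      rcases hs.split a with h1 | h1
      · exact ih h1
      · rcases hab.1.2.2.2 w hw h1 with h2 | h2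
        · exact ih (h2 ▸ Sep.right _ _)
        · exact hab.2 h2.symm

end sep

theorem sep_map {V W : Type} [Finite V] [Finite W] {g : SimpleGraph V} {g' : SimpleGraph W}
    (hg : g.Connected) (hg' : g'.Connected) {K : Set V} {K' : Set W} {φ : V → W}
    (hm : Set.MapsTo φ K K') (hi : Set.InjOn φ K)
    (hA : ∀ a b, SAdj g K a b → SAdj g' K' (φ a) (φ b))
    {u w v : V} (hu : u ∈ K) (hw : w ∈ K) (hv : v ∈ K) (h : Sep g' (φ u) (φ w) (φ v)) :
    Sep g u w v := by
  by_contra hn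
  revert h
  rw [imp_false, not_sep_iff hg' (hm hu) (hm hw) (hm hv)]
  rw [not_sep_iff hg hu hw hv] at hn
  refine ⟨fun h => hn.1 (hi hu hw h), ?_⟩
  refine Relation.ReflTransGen.lift φ ?_ _ _ hn.2
  rintro a b ⟨h1, h2⟩
  exact ⟨hA _ _ h1, fun h => h2 (hi h1.2.1 hw h)⟩

theorem sep_bij {V W : Type} [Finite V] [Finite W] {g : SimpleGraph V} {g' : SimpleGraph W}
    (hg : g.Connected) (hg' : g'.Connected) {K : Set V} {K' : Set W} {φ : V → W}
    (hb : Set.BijOn φ K K')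
    (hA : ∀ a b, a ∈ K → b ∈ K → (SAdj g K a b ↔ SAdj g' K' (φ a) (φ b)))
    {u w v : V} (hu : u ∈ K) (hw : w ∈ K) (hv : v ∈ K) :
    Sep g u w v ↔ Sep g' (φ u) (φ w) (φ v) := by
  have : Nonempty V := ⟨u⟩
  constructor
  · intro h
    have hinv := hb.invOn_invFunOn
    have hmaps : Set.MapsTo (Function.invFunOn φ K) K' K := hb.surjOn.mapsTo_invFunOn
    refine sep_map hg' hg hmaps (hinv.2.injOn) ?_ (hb.mapsTo hu) (hb.mapsTo hw) (hb.mapsTo hv) ?_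
    · intro a b hab
      rw [hA _ _ (hmaps hab.1) (hmaps hab.2.1), hinv.2 hab.1, hinv.2 hab.2.1]
      exact hab
    · rwa [hinv.1 hu, hinv.1 hw, hinv.1 hv]
  · exact sep_map hg hg' hb.mapsTo hb.injOn
      (fun a b h => (hA a b h.1 h.2.1).1 h) hu hw hv

section utree
variable {X : Type}

theorem u_span_iff (T : UTree X) {B : Set X} {v : T.V} :
    v ∈ T.spanSet B ↔ ∃ x ∈ B, ∃ y ∈ B, Sep T.g (T.label x) v (T.label y) := by
  simp only [UTree.spanSet, Set.mem_ofPred_eq, sep_iff T.isTree]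

theorem u_span_convex (T : UTree X) {B : Set X} {u v w : T.V} (hu : u ∈ T.spanSet B)
    (hv : v ∈ T.spanSet B) (h : Sep T.g u w v) : w ∈ T.spanSet B := by
  rw [u_span_iff] at *
  obtain ⟨a, ha, b, hb, hab⟩ := hu
  obtain ⟨c, hc, d, hd, hcd⟩ := hv
  have key : ∃ e ∈ B, Sep T.g v w (T.label e) := by
    rcases h.symm.push hab with h1 | h1
    exacts [⟨a, ha, h1⟩, ⟨b, hb, h1⟩]
  obtain ⟨e, he, hs⟩ := key
  rcases hs.symm.push hcd with h1 | h1
  exacts [⟨e, he, c, hc, h1⟩, ⟨e, he, d, hd, h1⟩]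

theorem u_keep_iff (T : UTree X) {B : Set X} {v : T.V} :
    v ∈ T.keepSet B ↔ ∃ x ∈ B, ∃ y ∈ B, ∃ z ∈ B, Sep T.g (T.label x) v (T.label y) ∧
      Sep T.g (T.label y) v (T.label z) ∧ Sep T.g (T.label x) v (T.label z) := by
  have := T.finV
  have hg := T.isTree
  constructor
  · rintro ⟨hv, ⟨x, hx, rfl⟩ | h3⟩
    · exact ⟨x, hx, x, hx, x, hx, Sep.left _ _, Sep.left _ _, Sep.left _ _⟩
    · have h3' : 2 < (T.g.neighborSet v ∩ T.spanSet B).ncard := h3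
      rw [Set.two_lt_ncard_iff (Set.toFinite _)] at h3'
      obtain ⟨n1, n2, n3, h1, h2, h3, d12, d13, d23⟩ := h3'
      have ex : ∀ n ∈ T.g.neighborSet v ∩ T.spanSet B, ∃ x ∈ B, Sep T.g v n (T.label x) := by
        rintro n ⟨_, hn⟩
        rw [u_span_iff] at hn
        obtain ⟨a, ha, b, hb, hab⟩ := hn
        rcases hab.split v with h | h
        exacts [⟨a, ha, h.symm⟩, ⟨b, hb, h⟩]
      have key : ∀ n ∈ T.g.neighborSet v ∩ T.spanSet B, ∀ m ∈ T.g.neighborSet v ∩ T.spanSet B,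
          n ≠ m → ∀ x y, Sep T.g v n x → Sep T.g v m y → Sep T.g x v y := by
        rintro n ⟨hn, _⟩ m ⟨hm, _⟩ hnm x y hx hy
        have hn' : T.g.Adj v n := hn
        have hm' : T.g.Adj v m := hm
        have e : Sep T.g n v m := by
          rcases Sep.edge hg.2 hn' m with h | h
          · rcases h.adj hm' with h | h
            · exact absurd h hn'.ne'
            · exact absurd h hnm
          · exact h
        rcases e.split x with h | h
        · exact absurd (hx.symm.antisymm hg.1 h.symm) hn'.ne'
        · rcases h.split y with h | h
          · exact h
          · exact absurd (hy.symm.antisymm hg.1 h) hm'.ne'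
      obtain ⟨x, hx, sx⟩ := ex _ h1
      obtain ⟨y, hy, sy⟩ := ex _ h2
      obtain ⟨z, hz, sz⟩ := ex _ h3
      exact ⟨x, hx, y, hy, z, hz, key _ h1 _ h2 d12 _ _ sx sy, key _ h2 _ h3 d23 _ _ sy sz,
        key _ h1 _ h3 d13 _ _ sx sz⟩
  · rintro ⟨x, hx, y, hy, z, hz, hxy, hyz, hxz⟩
    have hv : v ∈ T.spanSet B := (u_span_iff T).2 ⟨x, hx, y, hy, hxy⟩
    refine ⟨hv, ?_⟩
    by_cases hl : v ∈ T.label '' B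
    · exact Or.inl hl
    right
    have ne : ∀ x ∈ B, v ≠ T.label x := fun x hx h => hl ⟨x, hx, h.symm⟩
    have mem : ∀ n x y, x ∈ B → y ∈ B → Sep T.g (T.label x) v (T.label y) →
        Sep T.g v n (T.label x) → n ∈ T.spanSet B := by
      intro n x y hx hy h1 h2
      exact (u_span_iff T).2 ⟨x, hx, y, hy, h2.symm.trans h1⟩
    have dist : ∀ n m a b, Sep T.g a v b → T.g.Adj v n → Sep T.g v n a → Sep T.g v m b →
        n ≠ m := by
      rintro n _ a b hab hn ha hb rfl
      rcases hab.split n with h | h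
      · exact hn.ne' (ha.symm.antisymm hg.1 h)
      · exact hn.ne' (hb.symm.antisymm hg.1 h.symm)
    obtain ⟨n1, a1, s1⟩ := Sep.step hg (ne x hx)
    obtain ⟨n2, a2, s2⟩ := Sep.step hg (ne y hy)
    obtain ⟨n3, a3, s3⟩ := Sep.step hg (ne z hz)
    have : 2 < (T.g.neighborSet v ∩ T.spanSet B).ncard := by
      rw [Set.two_lt_ncard_iff (Set.toFinite _)]
      exact ⟨n1, n2, n3, ⟨a1, mem _ x y hx hy hxy s1⟩, ⟨a2, mem _ y z hy hz hyz s2⟩,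
        ⟨a3, mem _ z x hz hx hxz.symm s3⟩, dist _ _ _ _ hxy a1 s1 s2, dist _ _ _ _ hxz a1 s1 s3,
        dist _ _ _ _ hyz a2 s2 s3⟩
    exact this

theorem u_keep_mono (T : UTree X) {A B : Set X} (h : A ⊆ B) : T.keepSet A ⊆ T.keepSet B := by
  intro v hv
  rw [u_keep_iff] at *
  obtain ⟨x, hx, y, hy, z, hz, hh⟩ := hv
  exact ⟨x, h hx, y, h hy, z, h hz, hh⟩

theorem u_label_keep (T : UTree X) {B : Set X} {x : X} (hx : x ∈ B) : T.label x ∈ T.keepSet B :=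
  (u_keep_iff T).2 ⟨x, hx, x, hx, x, hx, Sep.left _ _, Sep.left _ _, Sep.left _ _⟩

theorem u_restAdj_iff (T : UTree X) {B : Set X} {u v : T.V} :
    T.restAdj B u v ↔ SAdj T.g (T.keepSet B) u v := by
  unfold UTree.restAdj SAdj
  refine and_congr_right fun hu => and_congr_right fun hv => and_congr_right fun hne => ?_
  constructor
  · rintro ⟨p, hp, _, h⟩ w hw hs
    exact h w (hs p) hw
  · intro h
    obtain ⟨p, hp⟩ := T.isTree.1.exists_isPath u v
    refine ⟨p, hp, fun w hw => ?_, fun w hw hk => ?_⟩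
    · exact u_span_convex T hu.1 hv.1 ((sep_iff T.isTree).1 ⟨p, hp, hw⟩)
    · exact h w hk ((sep_iff T.isTree).1 ⟨p, hp, hw⟩)

theorem u_adj_iff (T : UTree X) {u v : T.V} : T.g.Adj u v ↔ SAdj T.g Set.univ u v := by
  constructor
  · exact fun h => ⟨trivial, trivial, h.ne, fun w _ hs => hs.adj h⟩
  · rintro ⟨_, _, hne, h⟩
    obtain ⟨n, a, s⟩ := Sep.step T.isTree hne
    rcases h n trivial s with h | h
    · exact absurd h a.ne'
    · exact h ▸ a

theorem u_rest_sep {T : UTree X} {X' : Set X} {T' : UTree X'} {φ : T'.V → T.V}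
    (hi : Function.Injective φ) (hr : Set.range φ = T.keepSet X')
    (hA : ∀ u v : T'.V, T'.g.Adj u v ↔ T.restAdj X' (φ u) (φ v)) (u w v : T'.V) :
    Sep T'.g u w v ↔ Sep T.g (φ u) (φ w) (φ v) := by
  have := T.finV
  have := T'.finV
  refine sep_bij (K := Set.univ) (K' := T.keepSet X') T'.isTree.1 T.isTree.1 ?_ ?_
    trivial trivial trivial
  · rw [← hr, ← Set.image_univ]
    exact hi.injOn.bijOn_image
  · intro a b _ _
    rw [← u_adj_iff, hA, u_restAdj_iff]

theorem u_rest_keep {T : UTree X} {X' : Set X} {T' : UTree X'} {φ : T'.V → T.V}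
    (hl : ∀ x : X', φ (T'.label x) = T.label x.val)
    (hs : ∀ u w v, Sep T'.g u w v ↔ Sep T.g (φ u) (φ w) (φ v)) (B : Set X) (v : T'.V) :
    v ∈ T'.keepSet {x : X' | (x : X) ∈ B} ↔ φ v ∈ T.keepSet (B ∩ X') := by
  rw [u_keep_iff, u_keep_iff]
  simp only [hs, hl]
  constructor
  · rintro ⟨x, hx, y, hy, z, hz, h⟩
    exact ⟨x, ⟨hx, x.2⟩, y, ⟨hy, y.2⟩, z, ⟨hz, z.2⟩, h⟩
  · rintro ⟨x, hx, y, hy, z, hz, h⟩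
    exact ⟨⟨x, hx.2⟩, hx.1, ⟨y, hy.2⟩, hy.1, ⟨z, hz.2⟩, hz.1, h⟩

theorem u_main (𝒯 : Set (UTree X)) (F : Set (Set X)) (X' : Set X)
    (𝒯' : Set (UTree X')) (hF : UTree.IsAgreementForest 𝒯 F)
    (hR : UTree.IsRestrictionFamily 𝒯 X' 𝒯') :
    UTree.IsAgreementForest 𝒯'
        ((fun B => {x : X' | (x : X) ∈ B}) '' {B | B ∈ F ∧ (B ∩ X').Nonempty}) := by
  obtain ⟨⟨hne, hpart⟩, heq, hdis⟩ := hF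
  refine ⟨⟨?_, ?_⟩, ?_, ?_⟩
  · rintro _ ⟨B, ⟨hB, x, hx⟩, rfl⟩
    exact ⟨⟨x, hx.2⟩, hx.1⟩
  · intro x
    obtain ⟨B, ⟨hB, hx⟩, hu⟩ := hpart x
    refine ⟨_, ⟨⟨B, ⟨hB, x, hx, x.2⟩, rfl⟩, hx⟩, ?_⟩
    rintro _ ⟨⟨B2, ⟨hB2, _⟩, rfl⟩, hx2⟩
    rw [hu B2 ⟨hB2, hx2⟩]
  · rintro _ ⟨B, ⟨hB, _⟩, rfl⟩ T1' hT1' T2' hT2'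
    obtain ⟨T1, hT1, ψ1, i1, l1, r1, A1⟩ := hR.1 T1' hT1'
    obtain ⟨T2, hT2, ψ2, i2, l2, r2, A2⟩ := hR.1 T2' hT2'
    obtain ⟨φ, hb, hl, hA⟩ := heq B hB T1 hT1 T2 hT2
    have := T1.finV
    have := T2.finV
    have s1 := u_rest_sep i1 r1 A1
    have s2 := u_rest_sep i2 r2 A2
    have k1 := u_rest_keep l1 s1 B
    have k2 := u_rest_keep l2 s2 B
    have s : ∀ u w v, u ∈ T1.keepSet B → w ∈ T1.keepSet B → v ∈ T1.keepSet B →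
        (Sep T1.g u w v ↔ Sep T2.g (φ u) (φ w) (φ v)) := fun u w v hu hw hv =>
      sep_bij T1.isTree.1 T2.isTree.1 hb
        (fun a b ha hb => by rw [← u_restAdj_iff, hA a b ha hb, u_restAdj_iff]) hu hw hv
    have hsub : B ∩ X' ⊆ B := Set.inter_subset_left
    have hsub' : B ∩ X' ⊆ X' := Set.inter_subset_right
    have kφ : ∀ v ∈ T1.keepSet B, (v ∈ T1.keepSet (B ∩ X') ↔ φ v ∈ T2.keepSet (B ∩ X')) := by
      intro v hv
      rw [u_keep_iff, u_keep_iff]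
      refine exists_congr fun x => and_congr_right fun hx => exists_congr fun y =>
        and_congr_right fun hy => exists_congr fun z => and_congr_right fun hz => ?_
      have hx' := u_label_keep T1 hx.1
      have hy' := u_label_keep T1 hy.1
      have hz' := u_label_keep T1 hz.1
      rw [s _ _ _ hx' hv hy', s _ _ _ hy' hv hz', s _ _ _ hx' hv hz', hl x hx.1, hl y hy.1,
        hl z hz.1]
    have : Nonempty T2'.V := T2'.isTree.1.nonempty
    have inv2 : ∀ v ∈ T2.keepSet (B ∩ X'), ψ2 (Function.invFun ψ2 v) = v := by
      intro v hv
      have : v ∈ Set.range ψ2 := r2 ▸ u_keep_mono T2 hsub' hv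
      exact Function.invFun_eq this
    have hψ : ∀ v ∈ T1'.keepSet {x : X' | (x : X) ∈ B},
        ψ2 (Function.invFun ψ2 (φ (ψ1 v))) = φ (ψ1 v) := by
      intro v hv
      have h1 := (k1 v).1 hv
      exact inv2 _ ((kφ _ (u_keep_mono T1 hsub h1)).1 h1)
    have hb' : Set.BijOn (fun v => Function.invFun ψ2 (φ (ψ1 v)))
        (T1'.keepSet {x : X' | (x : X) ∈ B}) (T2'.keepSet {x : X' | (x : X) ∈ B}) := by
      refine ⟨fun v hv => ?_, fun u hu v hv h => ?_, fun v hv => ?_⟩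
      · rw [k2, hψ v hv, ← kφ _ (u_keep_mono T1 hsub ((k1 v).1 hv))]
        exact (k1 v).1 hv
      · have h' := congrArg ψ2 h
        simp only [hψ u hu, hψ v hv] at h'
        exact i1 (hb.injOn (u_keep_mono T1 hsub ((k1 u).1 hu))
          (u_keep_mono T1 hsub ((k1 v).1 hv)) h')
      · have h2 := (k2 v).1 hv
        obtain ⟨w, hw, hwv⟩ := hb.surjOn (u_keep_mono T2 hsub h2)
        have hw2 : w ∈ T1.keepSet (B ∩ X') := by rw [kφ w hw, hwv]; exact h2
        have : w ∈ Set.range ψ1 := r1 ▸ u_keep_mono T1 hsub' hw2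
        obtain ⟨w', rfl⟩ := this
        refine ⟨w', (k1 w').2 hw2, ?_⟩
        simp only [hwv]
        exact Function.leftInverse_invFun i2 v
    refine ⟨_, hb', ?_, ?_⟩
    · intro x hx
      apply i2
      rw [hψ _ (u_label_keep T1' hx), l1, hl x hx, l2]
    · intro u v hu hv
      rw [u_restAdj_iff, u_restAdj_iff]
      have key : ∀ u w v, u ∈ T1'.keepSet {x : X' | (x : X) ∈ B} →
          w ∈ T1'.keepSet {x : X' | (x : X) ∈ B} → v ∈ T1'.keepSet {x : X' | (x : X) ∈ B} →
          (Sep T1'.g u w v ↔ Sep T2'.g (Function.invFun ψ2 (φ (ψ1 u)))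
            (Function.invFun ψ2 (φ (ψ1 w))) (Function.invFun ψ2 (φ (ψ1 v)))) := by
        intro u w v hu hw hv
        rw [s1, s2, hψ _ hu, hψ _ hw, hψ _ hv, s]
        · exact u_keep_mono T1 hsub ((k1 _).1 hu)
        · exact u_keep_mono T1 hsub ((k1 _).1 hw)
        · exact u_keep_mono T1 hsub ((k1 _).1 hv)
      constructor
      · rintro ⟨_, _, hne, h⟩
        refine ⟨hb'.mapsTo hu, hb'.mapsTo hv, fun h => hne (hb'.injOn hu hv h), ?_⟩
        intro w hw hs
        obtain ⟨w, hw', rfl⟩ := hb'.surjOn hw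
        rcases h w hw' ((key _ _ _ hu hw' hv).2 hs) with rfl | rfl
        exacts [Or.inl rfl, Or.inr rfl]
      · rintro ⟨_, _, hne, h⟩
        refine ⟨hu, hv, fun h => hne (h ▸ rfl), ?_⟩
        intro w hw hs
        rcases h _ (hb'.mapsTo hw) ((key _ _ _ hu hw hv).1 hs) with h | h
        exacts [Or.inl (hb'.injOn hw hu h), Or.inr (hb'.injOn hw hv h)]
  · rintro _ ⟨B, ⟨hB, _⟩, rfl⟩ _ ⟨B2, ⟨hB2, _⟩, rfl⟩ hBB T' hT'
    obtain ⟨T, hT, ψ, i, l, r, A⟩ := hR.1 T' hT'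
    have s := u_rest_sep i r A
    have hd := hdis B hB B2 hB2 (fun h => hBB (h ▸ rfl)) T hT
    rw [Set.disjoint_left] at hd ⊢
    have key : ∀ (B : Set X) v, v ∈ T'.spanSet {x : X' | (x : X) ∈ B} → ψ v ∈ T.spanSet B := by
      intro B v hv
      rw [u_span_iff] at *
      obtain ⟨x, hx, y, hy, h⟩ := hv
      rw [s, l, l] at h
      exact ⟨x, hx, y, hy, h⟩
    exact fun v h1 h2 => hd (key _ _ h1) (key _ _ h2)

end utree

section rtree
variable {X : Type}

theorem r_parent (T : RTree X) {a b c : T.V} (h1 : T.E a c) (h2 : T.E b c) : a = b := by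
  have := T.finV
  have hc : c ≠ T.root := by
    rintro rfl
    exact T.not_into_root _ h1
  have := T.in_one c hc
  rw [Set.ncard_eq_one] at this
  obtain ⟨d, hd⟩ := this
  have e1 : a ∈ {u : T.V | T.E u c} := h1
  have e2 : b ∈ {u : T.V | T.E u c} := h2
  rw [hd] at e1 e2
  exact e1.trans e2.symm

theorem r_acyclic (T : RTree X) (v : T.V) : ¬ Relation.TransGen T.E v v := by
  induction T.reach_root v with
  | refl =>
    intro h
    obtain ⟨c, _, hc⟩ := Relation.TransGen.tail'_iff.1 h
    exact T.not_into_root _ hc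
  | @tail a b _ hab ih =>
    intro h
    obtain ⟨c, hbc, hc⟩ := Relation.TransGen.tail'_iff.1 h
    obtain rfl := r_parent T hab hc
    exact ih (Relation.TransGen.head' hab hbc)

theorem r_refl (T : RTree X) (u : T.V) : T.anc u u := Relation.ReflTransGen.refl

theorem r_trans (T : RTree X) {u v w : T.V} (h : T.anc u v) (h' : T.anc v w) : T.anc u w :=
  Relation.ReflTransGen.trans h h'

theorem r_edge (T : RTree X) {u v : T.V} (h : T.E u v) : T.anc u v :=
  Relation.ReflTransGen.single h

theorem r_edge_not (T : RTree X) {u v : T.V} (h : T.E u v) : ¬ T.anc v u :=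
  fun h' => r_acyclic T u (Relation.TransGen.head' h h')

theorem r_antisymm (T : RTree X) {u v : T.V} (h : T.anc u v) (h' : T.anc v u) : u = v := by
  rcases Relation.ReflTransGen.cases_head h with h1 | ⟨c, hc, hcv⟩
  · exact h1
  · exact absurd (r_trans T hcv h') (r_edge_not T hc)

theorem r_total (T : RTree X) {u v w : T.V} (h : T.anc u v) (h' : T.anc w v) :
    T.anc u w ∨ T.anc w u := by
  induction h with
  | refl => exact Or.inr h'
  | @tail a b hua hab ih =>
    rcases Relation.ReflTransGen.cases_tail h' with h1 | ⟨c, hwc, hcb⟩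
    · subst h1
      exact Or.inl (Relation.ReflTransGen.tail hua hab)
    · obtain rfl := r_parent T hab hcb
      exact ih hwc

/-- a proper ancestor of the child of `u` is an ancestor of `u` -/
theorem r_below (T : RTree X) {u c w : T.V} (h : T.E u c) (hw : T.anc w c) :
    w = c ∨ T.anc w u := by
  rcases Relation.ReflTransGen.cases_tail hw with h1 | ⟨d, hwd, hd⟩
  · exact Or.inl h1.symm
  · obtain rfl := r_parent T h hd
    exact Or.inr hwd

theorem r_child (T : RTree X) {u v : T.V} (h : T.anc u v) (hne : u ≠ v) :
    ∃ c, T.E u c ∧ T.anc c v := by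
  rcases Relation.ReflTransGen.cases_head h with h1 | h1
  exacts [absurd h1 hne, h1]

theorem r_sibling (T : RTree X) {v c d x : T.V} (hc : T.E v c) (hd : T.E v d)
    (h1 : T.anc c x) (h2 : T.anc d x) : c = d := by
  rcases r_total T h1 h2 with h | h
  · rcases r_below T hd h with h | h
    · exact h
    · exact absurd h (r_edge_not T hc)
  · rcases r_below T hc h with h | h
    · exact h.symm
    · exact absurd h (r_edge_not T hd)

/-- `v` is the last common ancestor of `x` and `y`, provided a child of `v` above `x` is not
above `y`. -/
theorem r_lca_of (T : RTree X) {v c x y : T.V} (hc : T.E v c) (hcx : T.anc c x)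
    (hcy : ¬ T.anc c y) (w : T.V) (hx : T.anc w x) (hy : T.anc w y) : T.anc w v := by
  rcases r_total T (r_trans T (r_edge T hc) hcx) hx with h | h
  · by_cases hvw : v = w
    · exact hvw ▸ r_refl T _
    · obtain ⟨d, hd, hdw⟩ := r_child T h hvw
      obtain rfl := r_sibling T hc hd hcx (r_trans T hdw hx)
      exact absurd (r_trans T hdw hy) hcy
  · exact h

theorem r_keep_iff (T : RTree X) {B : Set X} {v : T.V} :
    v ∈ T.keepSet B ↔ ∃ x ∈ B, ∃ y ∈ B, T.anc v (T.label x) ∧ T.anc v (T.label y) ∧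
      ∀ w, T.anc w (T.label x) → T.anc w (T.label y) → T.anc w v := by
  have := T.finV
  constructor
  · rintro ⟨hv, ⟨x, hx, rfl⟩ | h2⟩
    · exact ⟨x, hx, x, hx, r_refl T _, r_refl T _, fun w h _ => h⟩
    · have h2' : 1 < ({w : T.V | T.E v w} ∩ T.spanSet B).ncard := h2
      rw [Set.one_lt_ncard_iff (Set.toFinite _)] at h2'
      obtain ⟨c, d, ⟨hc, ⟨x, hx, hcx⟩, _⟩, ⟨hd, ⟨y, hy, hdy⟩, _⟩, hcd⟩ := h2'
      have hc' : T.E v c := hc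
      have hd' : T.E v d := hd
      refine ⟨x, hx, y, hy, r_trans T (r_edge T hc') hcx, r_trans T (r_edge T hd') hdy, ?_⟩
      exact r_lca_of T hc' hcx fun h => hcd (r_sibling T hc' hd' h hdy)
  · rintro ⟨x, hx, y, hy, hvx, hvy, hl⟩
    have hcom : ∀ w : T.V, (∀ x ∈ B, T.anc w (T.label x)) → T.anc w v :=
      fun w hw => hl w (hw x hx) (hw y hy)
    refine ⟨⟨⟨x, hx, hvx⟩, hcom⟩, ?_⟩
    by_cases hlab : v ∈ T.label '' B
    · exact Or.inl hlab
    right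
    have ne : ∀ x ∈ B, v ≠ T.label x := fun x hx h => hlab ⟨x, hx, h.symm⟩
    obtain ⟨c, hc, hcx⟩ := r_child T hvx (ne x hx)
    obtain ⟨d, hd, hdy⟩ := r_child T hvy (ne y hy)
    have : 1 < ({w : T.V | T.E v w} ∩ T.spanSet B).ncard := by
      rw [Set.one_lt_ncard_iff (Set.toFinite _)]
      refine ⟨c, d, ⟨hc, ⟨x, hx, hcx⟩, fun w hw => r_trans T (hcom w hw) (r_edge T hc)⟩,
        ⟨hd, ⟨y, hy, hdy⟩, fun w hw => r_trans T (hcom w hw) (r_edge T hd)⟩, ?_⟩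
      rintro rfl
      exact r_edge_not T hc (hl c hcx hdy)
    exact this

theorem r_keep_mono (T : RTree X) {A B : Set X} (h : A ⊆ B) : T.keepSet A ⊆ T.keepSet B := by
  intro v hv
  rw [r_keep_iff] at *
  obtain ⟨x, hx, y, hy, hh⟩ := hv
  exact ⟨x, h hx, y, h hy, hh⟩

theorem r_label_keep (T : RTree X) {B : Set X} {x : X} (hx : x ∈ B) : T.label x ∈ T.keepSet B :=
  (r_keep_iff T).2 ⟨x, hx, x, hx, r_refl T _, r_refl T _, fun _ h _ => h⟩

/-- Every nonempty set of leaves has a last common ancestor, and it is a kept vertex. -/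
theorem r_lca_set (T : RTree X) {B : Set X} (hB : B.Nonempty) :
    ∃ l ∈ T.keepSet B, (∀ x ∈ B, T.anc l (T.label x)) ∧
      ∀ w, (∀ x ∈ B, T.anc w (T.label x)) → T.anc w l := by
  have := T.finV
  obtain ⟨x, hx⟩ := hB
  obtain ⟨l, hl, hmax⟩ := Set.exists_max_image
    {w : T.V | ∀ x ∈ B, T.anc w (T.label x)} (fun w => {u | T.anc u w}.ncard)
    (Set.toFinite _) ⟨T.root, fun x _ => T.reach_root _⟩
  have hl' : ∀ x ∈ B, T.anc l (T.label x) := hl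
  have hgr : ∀ w, (∀ x ∈ B, T.anc w (T.label x)) → T.anc w l := by
    intro w hw
    rcases r_total T (hl' x hx) (hw x hx) with h | h
    · by_contra hc
      have hlt : {u | T.anc u l}.ncard < {u | T.anc u w}.ncard :=
        Set.ncard_lt_ncard ⟨fun u hu => r_trans T hu h, fun hs => hc (hs (r_refl T w))⟩
          (Set.toFinite _)
      have := hmax w hw
      omega
    · exact h
  refine ⟨l, ?_, hl', hgr⟩
  rw [r_keep_iff]
  by_cases hlx : l = T.label x
  · subst hlx
    exact ⟨x, hx, x, hx, r_refl T _, r_refl T _, fun _ h _ => h⟩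
  · obtain ⟨c, hc, hcx⟩ := r_child T (hl' x hx) hlx
    have : ∃ y ∈ B, ¬ T.anc c (T.label y) := by
      by_contra hn
      push Not at hn
      exact r_edge_not T hc (hgr c hn)
    obtain ⟨y, hy, hcy⟩ := this
    exact ⟨x, hx, y, hy, hl' x hx, hl' y hy, r_lca_of T hc hcx hcy⟩

/-- lca characterisation where the maximality is only tested on kept vertices -/
theorem r_keep_iff' (T : RTree X) {A B : Set X} (hAB : A ⊆ B) {v : T.V} :
    v ∈ T.keepSet A ↔ ∃ x ∈ A, ∃ y ∈ A, T.anc v (T.label x) ∧ T.anc v (T.label y) ∧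
      ∀ w ∈ T.keepSet B, T.anc w (T.label x) → T.anc w (T.label y) → T.anc w v := by
  rw [r_keep_iff]
  refine exists_congr fun x => and_congr_right fun hx => exists_congr fun y =>
    and_congr_right fun hy => and_congr_right fun hvx => and_congr_right fun hvy => ?_
  constructor
  · exact fun h w _ => h w
  · intro h w hwx hwy
    obtain ⟨l, hl, hc, hg⟩ := r_lca_set T (B := {x, y}) ⟨x, by simp⟩
    have hlB : l ∈ T.keepSet B := by
      refine r_keep_mono T ?_ hl
      rintro z (rfl | rfl)
      exacts [hAB hx, hAB hy]
    refine r_trans T (hg w ?_) (h l hlB (hc x (by simp)) (hc y (by simp)))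
    rintro z (rfl | rfl)
    exacts [hwx, hwy]

/-- covering relation of the ancestor order on the set `K` -/
def RAdj (T : RTree X) (K : Set T.V) (u v : T.V) : Prop :=
  u ∈ K ∧ v ∈ K ∧ u ≠ v ∧ T.anc u v ∧ ∀ w ∈ K, T.anc u w → T.anc w v → w = u ∨ w = v

theorem r_restAdj_iff (T : RTree X) {B : Set X} {u v : T.V} :
    T.restAdj B u v ↔ RAdj T (T.keepSet B) u v := by
  unfold RTree.restAdj RAdj
  refine and_congr_right fun hu => and_congr_right fun hv => and_congr_right fun hne => ?_
  constructor
  · intro h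
    refine ⟨Relation.ReflTransGen.mono (fun _ _ h => h.1) _ _ h, ?_⟩
    clear hu hne
    induction h using Relation.ReflTransGen.head_induction_on with
    | refl => exact fun w _ h1 h2 => Or.inl (r_antisymm T h2 h1)
    | @head a c hac hcv ih =>
      intro w hw h1 h2
      have hcv' : T.anc c v := Relation.ReflTransGen.mono (fun _ _ h => h.1) _ _ hcv
      rcases r_total T hcv' h2 with h | h
      · rcases ih w hw h h2 with h | h
        · rcases hac.2.2 with h3 | h3
          · exact Or.inr (h.trans h3)
          · exact absurd (h ▸ hw) h3
        · exact Or.inr h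
      · rcases r_below T hac.1 h with h | h
        · rcases hac.2.2 with h3 | h3
          · exact Or.inr (h.trans h3)
          · exact absurd (h ▸ hw) h3
        · exact Or.inl (r_antisymm T h h1)
  · rintro ⟨h, hb⟩
    have hus := hu.1
    clear hu hne
    induction h using Relation.ReflTransGen.head_induction_on with
    | refl => exact .refl
    | @head a c hac hcv ih =>
      have hcs : c ∈ T.spanSet B := by
        obtain ⟨x, hx, hvx⟩ := hv.1.1
        exact ⟨⟨x, hx, r_trans T hcv hvx⟩, fun w hw => r_trans T (hus.2 w hw) (r_edge T hac)⟩
      refine .head ⟨hac, hcs, ?_⟩ (ih (fun w hw h1 h2 => ?_) hcs)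
      · by_contra hn
        push Not at hn
        rcases hb c hn.2 (r_edge T hac) hcv with h | h
        · exact r_edge_not T hac (h ▸ r_refl T _)
        · exact hn.1 h
      · rcases hb w hw (r_trans T (r_edge T hac) h1) h2 with h | h
        · exact absurd (h ▸ h1) (r_edge_not T hac)
        · exact Or.inr h

theorem r_adj_iff (T : RTree X) {u v : T.V} : T.E u v ↔ RAdj T Set.univ u v := by
  constructor
  · refine fun h => ⟨trivial, trivial, ?_, r_edge T h, fun w _ h1 h2 => ?_⟩
    · rintro rfl
      exact r_edge_not T h (r_refl T _)
    · rcases r_below T h h2 with h | h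
      · exact Or.inr h
      · exact Or.inl (r_antisymm T h h1)
  · rintro ⟨_, _, hne, ha, h⟩
    obtain ⟨c, hc, hcv⟩ := r_child T ha hne
    rcases h c trivial (r_edge T hc) hcv with h | h
    · exact absurd (h ▸ r_refl T _) (r_edge_not T hc)
    · exact h ▸ hc

theorem radj_chain (T : RTree X) (K : Set T.V) (n : ℕ) :
    ∀ {u v : T.V}, {y | T.anc u y ∧ T.anc y v}.ncard ≤ n → u ∈ K → v ∈ K → T.anc u v →
      Relation.ReflTransGen (RAdj T K) u v := by
  have := T.finV
  induction n with
  | zero =>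
    intro u v h _ _ huv
    have : {y | T.anc u y ∧ T.anc y v} = ∅ := by
      rw [← Set.ncard_eq_zero (Set.toFinite _)]; omega
    have h2 : u ∈ {y | T.anc u y ∧ T.anc y v} := ⟨r_refl T _, huv⟩
    rw [this] at h2
    exact absurd h2 (by simp)
  | succ n ih =>
    intro u v hn hu hv hs
    by_cases huv : u = v
    · subst huv; exact .refl
    by_cases hA : RAdj T K u v
    · exact .single hA
    · have : ∃ x ∈ K, T.anc u x ∧ T.anc x v ∧ x ≠ u ∧ x ≠ v := by
        by_contra hc
        push Not at hc
        refine hA ⟨hu, hv, huv, hs, fun x hx h1 h2 => ?_⟩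
        by_contra h3
        push Not at h3
        exact h3.2 (hc x hx h1 h2 h3.1)
      obtain ⟨x, hx, hux, hxv, hxu, hxv'⟩ := this
      have l1 : {y | T.anc u y ∧ T.anc y x}.ncard < {y | T.anc u y ∧ T.anc y v}.ncard := by
        refine Set.ncard_lt_ncard ⟨fun y hy => ⟨hy.1, r_trans T hy.2 hxv⟩, fun hsub => ?_⟩
          (Set.toFinite _)
        have h4 := hsub (⟨hs, r_refl T v⟩ : v ∈ {y | T.anc u y ∧ T.anc y v})
        exact hxv' (r_antisymm T hxv h4.2)
      have l2 : {y | T.anc x y ∧ T.anc y v}.ncard < {y | T.anc u y ∧ T.anc y v}.ncard := by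
        refine Set.ncard_lt_ncard ⟨fun y hy => ⟨r_trans T hux hy.1, hy.2⟩, fun hsub => ?_⟩
          (Set.toFinite _)
        have h4 := hsub (⟨r_refl T u, hs⟩ : u ∈ {y | T.anc u y ∧ T.anc y v})
        exact hxu (r_antisymm T h4.1 hux)
      exact (ih (by omega) hu hx hux).trans (ih (by omega) hx hv hxv)

theorem anc_map {Y : Type} (T : RTree X) (T' : RTree Y) {K : Set T.V} {K' : Set T'.V}
    {φ : T.V → T'.V} (hA : ∀ a b, RAdj T K a b → RAdj T' K' (φ a) (φ b))
    {u v : T.V} (hu : u ∈ K) (hv : v ∈ K) (h : T.anc u v) : T'.anc (φ u) (φ v) := by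
  have h1 := radj_chain T K _ le_rfl hu hv h
  clear hv h
  induction h1 with
  | refl => exact r_refl T' _
  | tail _ hab ih => exact r_trans T' ih (hA _ _ hab).2.2.2.1

theorem anc_bij {Y : Type} (T : RTree X) (T' : RTree Y) {K : Set T.V} {K' : Set T'.V}
    {φ : T.V → T'.V} (hb : Set.BijOn φ K K')
    (hA : ∀ a b, a ∈ K → b ∈ K → (RAdj T K a b ↔ RAdj T' K' (φ a) (φ b)))
    {u v : T.V} (hu : u ∈ K) (hv : v ∈ K) : T.anc u v ↔ T'.anc (φ u) (φ v) := by
  have : Nonempty T.V := ⟨u⟩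
  constructor
  · exact anc_map T T' (fun a b h => (hA a b h.1 h.2.1).1 h) hu hv
  · intro h
    have hinv := hb.invOn_invFunOn
    have hmaps : Set.MapsTo (Function.invFunOn φ K) K' K := hb.surjOn.mapsTo_invFunOn
    have := anc_map T' T (K := K') (K' := K) (φ := Function.invFunOn φ K) ?_
      (hb.mapsTo hu) (hb.mapsTo hv) h
    · rwa [hinv.1 hu, hinv.1 hv] at this
    · intro a b hab
      rw [hA _ _ (hmaps hab.1) (hmaps hab.2.1), hinv.2 hab.1, hinv.2 hab.2.1]
      exact hab

theorem r_rest_anc {T : RTree X} {X' : Set X} {T' : RTree X'} {φ : T'.V → T.V}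
    (hi : Function.Injective φ) (hr : Set.range φ = T.keepSet X')
    (hA : ∀ u v : T'.V, T'.E u v ↔ T.restAdj X' (φ u) (φ v)) (u v : T'.V) :
    T'.anc u v ↔ T.anc (φ u) (φ v) := by
  refine anc_bij T' T (K := Set.univ) (K' := T.keepSet X') ?_ ?_ trivial trivial
  · rw [← hr, ← Set.image_univ]
    exact hi.injOn.bijOn_image
  · intro a b _ _
    rw [← r_adj_iff, hA, r_restAdj_iff]

theorem r_rest_keep {T : RTree X} {X' : Set X} {T' : RTree X'} {φ : T'.V → T.V}
    (hl : ∀ x : X', φ (T'.label x) = T.label x.val) (hr : Set.range φ = T.keepSet X')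
    (hs : ∀ u v, T'.anc u v ↔ T.anc (φ u) (φ v)) (B : Set X) (v : T'.V) :
    v ∈ T'.keepSet {x : X' | (x : X) ∈ B} ↔ φ v ∈ T.keepSet (B ∩ X') := by
  rw [r_keep_iff, r_keep_iff' T (B := X') Set.inter_subset_right, ← hr]
  simp only [hs, hl, Set.forall_mem_range]
  constructor
  · rintro ⟨x, hx, y, hy, h⟩
    exact ⟨x, ⟨hx, x.2⟩, y, ⟨hy, y.2⟩, h⟩
  · rintro ⟨x, hx, y, hy, h⟩
    exact ⟨⟨x, hx.2⟩, hx.1, ⟨y, hy.2⟩, hy.1, h⟩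

theorem r_main (𝒯 : Set (RTree X)) (F : Set (Set X)) (X' : Set X)
    (𝒯' : Set (RTree X')) (hF : RTree.IsAgreementForest 𝒯 F)
    (hR : RTree.IsRestrictionFamily 𝒯 X' 𝒯') :
    RTree.IsAgreementForest 𝒯'
        ((fun B => {x : X' | (x : X) ∈ B}) '' {B | B ∈ F ∧ (B ∩ X').Nonempty}) := by
  obtain ⟨⟨hne, hpart⟩, heq, hdis⟩ := hF
  refine ⟨⟨?_, ?_⟩, ?_, ?_⟩
  · rintro _ ⟨B, ⟨hB, x, hx⟩, rfl⟩
    exact ⟨⟨x, hx.2⟩, hx.1⟩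
  · intro x
    obtain ⟨B, ⟨hB, hx⟩, hu⟩ := hpart x
    refine ⟨_, ⟨⟨B, ⟨hB, x, hx, x.2⟩, rfl⟩, hx⟩, ?_⟩
    rintro _ ⟨⟨B2, ⟨hB2, _⟩, rfl⟩, hx2⟩
    rw [hu B2 ⟨hB2, hx2⟩]
  · rintro _ ⟨B, ⟨hB, _⟩, rfl⟩ T1' hT1' T2' hT2'
    obtain ⟨T1, hT1, ψ1, i1, l1, r1, A1⟩ := hR.1 T1' hT1'
    obtain ⟨T2, hT2, ψ2, i2, l2, r2, A2⟩ := hR.1 T2' hT2'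
    obtain ⟨φ, hb, hl, hA⟩ := heq B hB T1 hT1 T2 hT2
    have s1 := r_rest_anc i1 r1 A1
    have s2 := r_rest_anc i2 r2 A2
    have k1 := r_rest_keep l1 r1 s1 B
    have k2 := r_rest_keep l2 r2 s2 B
    have s : ∀ u v, u ∈ T1.keepSet B → v ∈ T1.keepSet B →
        (T1.anc u v ↔ T2.anc (φ u) (φ v)) := fun u v hu hv =>
      anc_bij T1 T2 hb
        (fun a b ha hb => by rw [← r_restAdj_iff, hA a b ha hb, r_restAdj_iff]) hu hv
    have hsub : B ∩ X' ⊆ B := Set.inter_subset_left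
    have hsub' : B ∩ X' ⊆ X' := Set.inter_subset_right
    have kφ : ∀ v ∈ T1.keepSet B, (v ∈ T1.keepSet (B ∩ X') ↔ φ v ∈ T2.keepSet (B ∩ X')) := by
      intro v hv
      rw [r_keep_iff' T1 hsub, r_keep_iff' T2 hsub]
      refine exists_congr fun x => and_congr_right fun hx => exists_congr fun y =>
        and_congr_right fun hy => ?_
      have hx' := r_label_keep T1 hx.1
      have hy' := r_label_keep T1 hy.1
      rw [s _ _ hv hx', s _ _ hv hy', ← hl x hx.1, ← hl y hy.1]
      refine and_congr_right fun _ => and_congr_right fun _ => ?_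
      constructor
      · intro h w hw h1 h2
        obtain ⟨w, hw', rfl⟩ := hb.surjOn hw
        rw [← s _ _ hw' hx'] at h1
        rw [← s _ _ hw' hy'] at h2
        rw [← s _ _ hw' hv]
        exact h w hw' h1 h2
      · intro h w hw h1 h2
        rw [s _ _ hw hx'] at h1
        rw [s _ _ hw hy'] at h2
        rw [s _ _ hw hv]
        exact h _ (hb.mapsTo hw) h1 h2
    have : Nonempty T2'.V := ⟨T2'.root⟩
    have inv2 : ∀ v ∈ T2.keepSet (B ∩ X'), ψ2 (Function.invFun ψ2 v) = v := by
      intro v hv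
      have : v ∈ Set.range ψ2 := r2 ▸ r_keep_mono T2 hsub' hv
      exact Function.invFun_eq this
    have hψ : ∀ v ∈ T1'.keepSet {x : X' | (x : X) ∈ B},
        ψ2 (Function.invFun ψ2 (φ (ψ1 v))) = φ (ψ1 v) := by
      intro v hv
      have h1 := (k1 v).1 hv
      exact inv2 _ ((kφ _ (r_keep_mono T1 hsub h1)).1 h1)
    have hb' : Set.BijOn (fun v => Function.invFun ψ2 (φ (ψ1 v)))
        (T1'.keepSet {x : X' | (x : X) ∈ B}) (T2'.keepSet {x : X' | (x : X) ∈ B}) := by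
      refine ⟨fun v hv => ?_, fun u hu v hv h => ?_, fun v hv => ?_⟩
      · rw [k2, hψ v hv, ← kφ _ (r_keep_mono T1 hsub ((k1 v).1 hv))]
        exact (k1 v).1 hv
      · have h' := congrArg ψ2 h
        simp only [hψ u hu, hψ v hv] at h'
        exact i1 (hb.injOn (r_keep_mono T1 hsub ((k1 u).1 hu))
          (r_keep_mono T1 hsub ((k1 v).1 hv)) h')
      · have h2 := (k2 v).1 hv
        obtain ⟨w, hw, hwv⟩ := hb.surjOn (r_keep_mono T2 hsub h2)
        have hw2 : w ∈ T1.keepSet (B ∩ X') := by rw [kφ w hw, hwv]; exact h2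
        have : w ∈ Set.range ψ1 := r1 ▸ r_keep_mono T1 hsub' hw2
        obtain ⟨w', rfl⟩ := this
        refine ⟨w', (k1 w').2 hw2, ?_⟩
        simp only [hwv]
        exact Function.leftInverse_invFun i2 v
    refine ⟨_, hb', ?_, ?_⟩
    · intro x hx
      apply i2
      rw [hψ _ (r_label_keep T1' hx), l1, hl x hx, l2]
    · intro u v hu hv
      rw [r_restAdj_iff, r_restAdj_iff]
      have key : ∀ u v, u ∈ T1'.keepSet {x : X' | (x : X) ∈ B} →
          v ∈ T1'.keepSet {x : X' | (x : X) ∈ B} →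
          (T1'.anc u v ↔ T2'.anc (Function.invFun ψ2 (φ (ψ1 u)))
            (Function.invFun ψ2 (φ (ψ1 v)))) := by
        intro u v hu hv
        rw [s1, s2, hψ _ hu, hψ _ hv, s]
        · exact r_keep_mono T1 hsub ((k1 _).1 hu)
        · exact r_keep_mono T1 hsub ((k1 _).1 hv)
      constructor
      · rintro ⟨_, _, hne, ha, h⟩
        refine ⟨hb'.mapsTo hu, hb'.mapsTo hv, fun h => hne (hb'.injOn hu hv h),
          (key _ _ hu hv).1 ha, ?_⟩
        intro w hw hs1 hs2
        obtain ⟨w, hw', rfl⟩ := hb'.surjOn hw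
        rcases h w hw' ((key _ _ hu hw').2 hs1) ((key _ _ hw' hv).2 hs2) with rfl | rfl
        exacts [Or.inl rfl, Or.inr rfl]
      · rintro ⟨_, _, hne, ha, h⟩
        refine ⟨hu, hv, fun h => hne (h ▸ rfl), (key _ _ hu hv).2 ha, ?_⟩
        intro w hw hs1 hs2
        rcases h _ (hb'.mapsTo hw) ((key _ _ hu hw).1 hs1) ((key _ _ hw hv).1 hs2) with h | h
        exacts [Or.inl (hb'.injOn hw hu h), Or.inr (hb'.injOn hw hv h)]
  · rintro _ ⟨B, ⟨hB, _⟩, rfl⟩ _ ⟨B2, ⟨hB2, _⟩, rfl⟩ hBB T' hT'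
    obtain ⟨T, hT, ψ, i, l, r, A⟩ := hR.1 T' hT'
    have s := r_rest_anc i r A
    have hd := hdis B hB B2 hB2 (fun h => hBB (h ▸ rfl)) T hT
    rw [Set.disjoint_left] at hd ⊢
    have key : ∀ (B : Set X) v, v ∈ T'.spanSet {x : X' | (x : X) ∈ B} → ψ v ∈ T.spanSet B := by
      rintro B v ⟨⟨x, hx, hvx⟩, hv⟩
      rw [s, l] at hvx
      refine ⟨⟨x, hx, hvx⟩, fun w hw => ?_⟩
      obtain ⟨m, hm, hmc, hmg⟩ := r_lca_set T (B := B ∩ X') ⟨x, hx, x.2⟩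
      have : m ∈ Set.range ψ := r ▸ r_keep_mono T Set.inter_subset_right hm
      obtain ⟨m', rfl⟩ := this
      refine r_trans T (hmg w fun y hy => hw y hy.1) ((s _ _).1 (hv m' fun y hy => ?_))
      rw [s, l]
      exact hmc y ⟨hy, y.2⟩
    exact fun v h1 h2 => hd (key _ _ h1) (key _ _ h2)

end rtree

theorem ncard_le {X : Type} (hX : Finite X) (F : Set (Set X)) (X' : Set X) :
    ((fun B => {x : X' | (x : X) ∈ B}) '' {B | B ∈ F ∧ (B ∩ X').Nonempty}).ncard ≤ F.ncard :=
  (Set.ncard_image_le (Set.toFinite _)).trans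
    (Set.ncard_le_ncard (fun _ h => h.1) (Set.toFinite _))

end PhyloAux

/-- **Observation 1.** Let `𝒯` be a set of (rooted or unrooted) binary phylogenetic
trees on a finite taxon set `X` and `F` an agreement forest for `𝒯`. If `X' ⊆ X`, then
`F' = { B ∩ X' : B ∈ F, B ∩ X' ≠ ∅ }` is an agreement forest for
`𝒯' = { T|X' : T ∈ 𝒯 }` and `|F'| ≤ |F|`. -/
theorem agreement_forest_closed_under_restriction :
    (∀ (X : Type), Finite X → ∀ (𝒯 : Set (UTree X)) (F : Set (Set X)) (X' : Set X)
      (𝒯' : Set (UTree X')),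
      UTree.IsAgreementForest 𝒯 F →
      UTree.IsRestrictionFamily 𝒯 X' 𝒯' →
      UTree.IsAgreementForest 𝒯'
        ((fun B => {x : X' | (x : X) ∈ B}) '' {B | B ∈ F ∧ (B ∩ X').Nonempty}) ∧
      ((fun B => {x : X' | (x : X) ∈ B}) '' {B | B ∈ F ∧ (B ∩ X').Nonempty}).ncard
        ≤ F.ncard) ∧
    (∀ (X : Type), Finite X → ∀ (𝒯 : Set (RTree X)) (F : Set (Set X)) (X' : Set X)
      (𝒯' : Set (RTree X')),
      RTree.IsAgreementForest 𝒯 F →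
      RTree.IsRestrictionFamily 𝒯 X' 𝒯' →
      RTree.IsAgreementForest 𝒯'
        ((fun B => {x : X' | (x : X) ∈ B}) '' {B | B ∈ F ∧ (B ∩ X').Nonempty}) ∧
      ((fun B => {x : X' | (x : X) ∈ B}) '' {B | B ∈ F ∧ (B ∩ X').Nonempty}).ncard
        ≤ F.ncard) := by
  exact ⟨fun X hX 𝒯 F X' 𝒯' hF hR =>
      ⟨PhyloAux.u_main 𝒯 F X' 𝒯' hF hR, PhyloAux.ncard_le hX F X'⟩,
    fun X hX 𝒯 F X' 𝒯' hF hR =>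
      ⟨PhyloAux.r_main 𝒯 F X' 𝒯' hF hR, PhyloAux.ncard_le hX F X'⟩⟩
end

section
/- Let 𝒯 be a set of unrooted binary phylogenetic trees on X, let S ⊆ X induce a common pendant subtree of 𝒯, and let 𝒯_S be the result of applying the subtree reduction rule to 𝒯 with respect to S. Then for every integer k, 𝒯_S has an unrooted agreement forest of size at most k if and only if 𝒯 has an unrooted agreement forest of size at most k. -/
namespace STR

/-- Abstract properties of the distance function of a tree. -/
structure TM {V : Type} (d : V → V → ℕ) : Prop where
  self : ∀ u, d u u = 0
  eq : ∀ u v, d u v = 0 → u = v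
  symm : ∀ u v, d u v = d v u
  tri : ∀ u v w, d u w ≤ d u v + d v w
  nbr : ∀ u v, u ≠ v → ∃ n, d u n = 1 ∧ d n v + 1 = d u v
  med : ∀ a b c, ∃ m, d a m + d m b = d a b ∧ d b m + d m c = d b c ∧ d a m + d m c = d a c
  fp : ∀ a b c e, d a b + d c e ≤ d a c + d b e ∨ d a b + d c e ≤ d a e + d b c

section graph
variable {V : Type} {G : SimpleGraph V}

lemma path_length (hG : G.IsTree) {a b : V} (p : G.Walk a b) (hp : p.IsPath) :
    p.length = G.dist a b := by
  obtain ⟨q, hq, hl⟩ := hG.1.exists_path_of_dist a b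
  rw [← hl, (hG.existsUnique_path a b).unique hp hq]

lemma bt_of_mem (hG : G.IsTree) {a b w : V} (p : G.Walk a b) (hp : p.IsPath)
    (hw : w ∈ p.support) : G.dist a w + G.dist w b = G.dist a b := by
  classical
  have h1 := path_length hG p hp
  have h2 := congrArg SimpleGraph.Walk.length (p.take_spec hw)
  rw [SimpleGraph.Walk.length_append] at h2
  have h3 := path_length hG _ (hp.takeUntil hw)
  have h4 := path_length hG _ (hp.dropUntil hw)
  omega

lemma mem_of_bt (hG : G.IsTree) {a b w : V} (p : G.Walk a b)
    (h : G.dist a w + G.dist w b = G.dist a b) : w ∈ p.support := by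
  classical
  obtain ⟨q, hq, hql⟩ := hG.1.exists_path_of_dist a w
  obtain ⟨r, hr, hrl⟩ := hG.1.exists_path_of_dist w b
  have h1 : (q.append r).IsPath := by
    apply SimpleGraph.Walk.isPath_of_length_eq_dist
    rw [SimpleGraph.Walk.length_append]; omega
  have h2 := (hG.existsUnique_path a b).unique h1 p.bypass_isPath
  apply p.support_bypass_subset_support
  rw [← h2]
  simp [SimpleGraph.Walk.mem_support_append_iff]

lemma bt_split (hG : G.IsTree) {a b w : V} (c : V)
    (h : G.dist a w + G.dist w b = G.dist a b) :
    G.dist a w + G.dist w c = G.dist a c ∨ G.dist c w + G.dist w b = G.dist c b := by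
  obtain ⟨q, hq, hql⟩ := hG.1.exists_path_of_dist a c
  obtain ⟨r, hr, hrl⟩ := hG.1.exists_path_of_dist c b
  have := mem_of_bt hG (q.append r) h
  rw [SimpleGraph.Walk.mem_support_append_iff] at this
  rcases this with h | h
  · exact Or.inl (bt_of_mem hG q hq h)
  · exact Or.inr (bt_of_mem hG r hr h)

lemma nbr_exists (hG : G.IsTree) (u v : V) (h : u ≠ v) :
    ∃ n, G.dist u n = 1 ∧ G.dist n v + 1 = G.dist u v := by
  obtain ⟨q, hq, hql⟩ := hG.1.exists_path_of_dist u v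
  cases q with
  | nil => exact absurd rfl h
  | cons hadj r =>
    rename_i n
    have hr := path_length hG r hq.of_cons
    refine ⟨n, SimpleGraph.dist_eq_one_iff_adj.2 hadj, ?_⟩
    rw [SimpleGraph.Walk.length_cons] at hql
    omega

lemma med_exists (hG : G.IsTree) (c : V) : ∀ (k : ℕ) (a b : V), G.dist a b = k →
    ∃ m, G.dist a m + G.dist m b = G.dist a b ∧ G.dist b m + G.dist m c = G.dist b c ∧
      G.dist a m + G.dist m c = G.dist a c := by
  intro k
  induction k with
  | zero =>
    intro a b h
    have : a = b := hG.1.dist_eq_zero_iff.1 h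
    subst this
    exact ⟨a, by simp⟩
  | succ k ih =>
    intro a b h
    have hne : a ≠ b := by rintro rfl; simp at h
    obtain ⟨n, hn1, hn2⟩ := nbr_exists hG a b hne
    have hadj := SimpleGraph.dist_eq_one_iff_adj.1 hn1
    obtain ⟨m, h1, h2, h3⟩ := ih n b (by omega)
    have t := hG.1.dist_triangle (u := a) (v := n) (w := m)
    have t2 := hG.1.dist_triangle (u := a) (v := m) (w := c)
    have t3 := hG.1.dist_triangle (u := a) (v := m) (w := b)
    have c1 := SimpleGraph.dist_comm (G := G) (u := a) (v := c)
    have c2 := SimpleGraph.dist_comm (G := G) (u := n) (v := c)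
    have c3 := SimpleGraph.dist_comm (G := G) (u := a) (v := b)
    have c4 := SimpleGraph.dist_comm (G := G) (u := b) (v := c)
    rcases hG.dist_eq_dist_add_one_of_adj c hadj with h4 | h4
    · exact ⟨m, by omega, h2, by omega⟩
    · refine ⟨a, by simp, ?_, by simp⟩
      rcases bt_split hG c (show G.dist a n + G.dist n b = G.dist a b by omega) with h5 | h5
      · omega
      · omega

lemma tm_dist (hG : G.IsTree) : TM (fun u v => G.dist u v) where
  self := fun u => by simp
  eq := fun u v h => hG.1.dist_eq_zero_iff.1 h
  symm := fun u v => SimpleGraph.dist_comm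
  tri := fun u v w => hG.1.dist_triangle
  nbr := nbr_exists hG
  med := fun a b c => med_exists hG c _ a b rfl
  fp := fun a b c e => by
    show G.dist a b + G.dist c e ≤ G.dist a c + G.dist b e ∨
      G.dist a b + G.dist c e ≤ G.dist a e + G.dist b c
    obtain ⟨m, h1, h2, h3⟩ := med_exists hG c _ a b rfl
    have s1 := bt_split hG e h1
    have s2 := bt_split hG e h2
    have s3 := bt_split hG e h3
    have t := hG.1.dist_triangle (u := c) (v := m) (w := e)
    have c1 := SimpleGraph.dist_comm (G := G) (u := e) (v := m)
    have c2 := SimpleGraph.dist_comm (G := G) (u := e) (v := a)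
    have c3 := SimpleGraph.dist_comm (G := G) (u := e) (v := b)
    have c4 := SimpleGraph.dist_comm (G := G) (u := e) (v := c)
    have c5 := SimpleGraph.dist_comm (G := G) (u := m) (v := a)
    have c6 := SimpleGraph.dist_comm (G := G) (u := m) (v := b)
    have c7 := SimpleGraph.dist_comm (G := G) (u := m) (v := c)
    omega

end graph

/-- Betweenness. -/
def bt {V : Type} (d : V → V → ℕ) (u w v : V) : Prop := d u w + d w v = d u v

/-- `m` is the median of `a, b, c`. -/
def IsMed {V : Type} (d : V → V → ℕ) (m a b c : V) : Prop := bt d a m b ∧ bt d b m c ∧ bt d a m c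

/-- The paths `a b` and `c e` meet. -/
def MM {V : Type} (d : V → V → ℕ) (a b c e : V) : Prop := ∃ w, bt d a w b ∧ bt d c w e

/-- Adjacency relative to a set of kept vertices. -/
def radj {V : Type} (d : V → V → ℕ) (K : Set V) (u v : V) : Prop :=
  u ∈ K ∧ v ∈ K ∧ u ≠ v ∧ ∀ w ∈ K, bt d u w v → w = u ∨ w = v

section metric
variable {V : Type} {d : V → V → ℕ}

lemma TM.three (h : TM d) (a b c : V) :
    (d a b = d b a ∧ d a c = d c a ∧ d b c = d c b) ∧
    (d a b ≤ d a c + d c b ∧ d a c ≤ d a b + d b c ∧ d b c ≤ d b a + d a c) :=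
  ⟨⟨h.symm _ _, h.symm _ _, h.symm _ _⟩, h.tri _ _ _, h.tri _ _ _, h.tri _ _ _⟩

lemma TM.four (h : TM d) (a b c e : V) :
    (d a b = d b a ∧ d a c = d c a ∧ d a e = d e a ∧ d b c = d c b ∧ d b e = d e b ∧
      d c e = d e c) ∧
    (d a b ≤ d a c + d c b ∧ d a c ≤ d a b + d b c ∧ d b c ≤ d b a + d a c) ∧
    (d a b ≤ d a e + d e b ∧ d a e ≤ d a b + d b e ∧ d b e ≤ d b a + d a e) ∧
    (d a e ≤ d a c + d c e ∧ d a c ≤ d a e + d e c ∧ d e c ≤ d e a + d a c) ∧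
    (d e b ≤ d e c + d c b ∧ d e c ≤ d e b + d b c ∧ d b c ≤ d b e + d e c) ∧
    (d a b + d c e ≤ d a c + d b e ∨ d a b + d c e ≤ d a e + d b c) ∧
    (d a c + d b e ≤ d a b + d c e ∨ d a c + d b e ≤ d a e + d b c) ∧
    (d a e + d b c ≤ d a b + d c e ∨ d a e + d b c ≤ d a c + d b e) := by
  have h1 := h.fp a b c e
  have h2 := h.fp a c b e
  have h3 := h.fp a e b c
  have t1 := h.three a b c
  have t2 := h.three a b e
  have t3 := h.three a c e
  have t4 := h.three b c e
  omega

lemma TM.pos (h : TM d) {a b : V} (hab : a ≠ b) : 0 < d a b :=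
  Nat.pos_of_ne_zero (fun h0 => hab (h.eq _ _ h0))

lemma bt_left (h : TM d) (u v : V) : bt d u u v := by
  have := h.self u; unfold bt; omega

lemma bt_right (h : TM d) (u v : V) : bt d u v v := by
  have := h.self v; unfold bt; omega

lemma bt_symm (h : TM d) {u w v : V} (hb : bt d u w v) : bt d v w u := by
  have := h.three u w v; unfold bt at *; omega

lemma bt_self (h : TM d) {u w : V} (hb : bt d u w u) : w = u := by
  have := h.self u; unfold bt at *; exact h.eq _ _ (by omega)

lemma split (h : TM d) {a w b : V} (c : V) (hb : bt d a w b) : bt d a w c ∨ bt d c w b := by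
  have := h.four a b c w; unfold bt at *; omega

lemma chain (h : TM d) {x u v y : V} (h1 : bt d x u v) (h2 : bt d u v y) (hne : u ≠ v) :
    d x y = d x u + d u v + d v y := by
  have := h.four x u v y
  have := h.pos hne
  unfold bt at *; omega

/-- `x - u - v - y` read off in pieces. -/
lemma bt_extend (h : TM d) {a u b w : V} (h1 : bt d a u b) (h2 : bt d a w u) :
    bt d a w b ∧ bt d w u b := by
  have := h.three a u b
  have := h.three w u b
  have := h.three a w b
  unfold bt at *; omega

lemma bt_antisymm (h : TM d) {x u w : V} (h1 : bt d x u w) (h2 : bt d x w u) : u = w := by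
  have := h.three x u w
  unfold bt at *; exact h.eq _ _ (by omega)

lemma med_of (h : TM d) (a b c : V) : ∃ m, IsMed d m a b c := h.med a b c

lemma MM_iff_le (h : TM d) (a b c e : V) : MM d a b c e ↔ d a c + d b e ≤ d a b + d c e := by
  constructor
  · rintro ⟨w, h1, h2⟩
    have := h.four a b c w
    have := h.four a b e w
    unfold bt at *; omega
  · intro hle
    obtain ⟨m, h1, h2, h3⟩ := med_of h a b c
    refine ⟨m, h1, ?_⟩
    have t := h.four b c e m
    have t := h.three a b m
    have t := h.three a c m
    rcases split h e h2 with h4 | h4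
    · unfold bt at *; omega
    · exact bt_symm h h4

lemma MM_med (h : TM d) {a b c e : V} (hm : MM d a b c e) :
    ∃ w, IsMed d w a b c ∧ bt d c w e := by
  have hle := (MM_iff_le h a b c e).1 hm
  obtain ⟨m, h1, h2, h3⟩ := med_of h a b c
  refine ⟨m, ⟨h1, h2, h3⟩, ?_⟩
  have t := h.four b c e m
  have t := h.three a b m
  have t := h.three a c m
  rcases split h e h2 with h4 | h4
  · unfold bt at *; omega
  · exact bt_symm h h4

lemma MM_swap1 (h : TM d) {a b c e : V} : MM d a b c e ↔ MM d b a c e :=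
  ⟨fun ⟨w, h1, h2⟩ => ⟨w, bt_symm h h1, h2⟩, fun ⟨w, h1, h2⟩ => ⟨w, bt_symm h h1, h2⟩⟩

lemma MM_swap2 (h : TM d) {a b c e : V} : MM d a b c e ↔ MM d a b e c :=
  ⟨fun ⟨w, h1, h2⟩ => ⟨w, h1, bt_symm h h2⟩, fun ⟨w, h1, h2⟩ => ⟨w, h1, bt_symm h h2⟩⟩

lemma MM_swap3 {a b c e : V} : MM d a b c e ↔ MM d c e a b :=
  ⟨fun ⟨w, h1, h2⟩ => ⟨w, h2, h1⟩, fun ⟨w, h1, h2⟩ => ⟨w, h2, h1⟩⟩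

lemma med_unique (h : TM d) {m n a b c : V} (h1 : IsMed d m a b c) (h2 : IsMed d n a b c) :
    m = n := by
  obtain ⟨h1, h3, h5⟩ := h1
  obtain ⟨h2, h4, h6⟩ := h2
  apply h.eq
  have := h.four a b m n
  have := h.three a c m
  have := h.three a c n
  have := h.three b c m
  have := h.three b c n
  unfold bt at *; omega

lemma helly (h : TM d) {m a b c : V} (hm : IsMed d m a b c) (p q : V) :
    bt d p m q ↔ MM d a b p q ∧ MM d b c p q ∧ MM d a c p q := by
  obtain ⟨h1, h2, h3⟩ := hm
  constructor
  · intro hb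
    exact ⟨⟨m, h1, hb⟩, ⟨m, h2, hb⟩, ⟨m, h3, hb⟩⟩
  · rintro ⟨m1, m2, m3⟩
    have m1' := (MM_iff_le h _ _ _ _).1 ((MM_swap1 h).1 m1)
    have m2' := (MM_iff_le h _ _ _ _).1 ((MM_swap1 h).1 m2)
    have m3' := (MM_iff_le h _ _ _ _).1 ((MM_swap1 h).1 m3)
    rw [MM_iff_le h] at m1 m2 m3
    have s1 := split h p h1
    have s2 := split h p h2
    have s3 := split h p h3
    have s4 := split h q h1
    have s5 := split h q h2
    have s6 := split h q h3
    have t1 := h.three a m p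
    have t2 := h.three b m p
    have t3 := h.three c m p
    have t4 := h.three a m q
    have t5 := h.three b m q
    have t6 := h.three c m q
    have t7 := h.three p m q
    have t8 := h.three a b m
    have t9 := h.three b c m
    unfold bt at *
    clear h
    rcases s1 with s1 | s1 <;> rcases s4 with s4 | s4 <;> omega

lemma med_dir (h : TM d) {u a b c : V} (hm : IsMed d u a b c) (v w : V) :
    ∃ x, (x = a ∨ x = b ∨ x = c) ∧ bt d x u v ∧ bt d x u w := by
  obtain ⟨h1, h2, h3⟩ := hm
  have s1 := split h v h1
  have s2 := split h v h2
  have s3 := split h v h3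
  have s4 := split h w h1
  have s5 := split h w h2
  have s6 := split h w h3
  have e : ∀ z y, bt d z u y ↔ bt d y u z := fun z y => ⟨bt_symm h, bt_symm h⟩
  rw [e v] at s1 s2 s3
  rw [e w] at s4 s5 s6
  by_cases ha : bt d a u v ∧ bt d a u w
  · exact ⟨a, by simp, ha⟩
  by_cases hb : bt d b u v ∧ bt d b u w
  · exact ⟨b, by simp, hb⟩
  exact ⟨c, by simp, by tauto, by tauto⟩

lemma bt_conv (h : TM d) {p q u v w : V} (h1 : bt d p u q) (h2 : bt d p v q) (h3 : bt d u w v) :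
    bt d p w q := by
  have := h.three p w q
  have := h.three p u w
  have := h.three p v w
  have := h.three q u w
  have := h.three q v w
  have := h.three p u v
  have := h.three q u v
  have s := split h v h1
  unfold bt at *; omega

lemma sep (h : TM d) {u v w a b c a' b' c' : V} (hu : IsMed d u a b c) (hv : IsMed d v a' b' c')
    (hne : u ≠ v) (hw : ¬ bt d u w v) :
    ∃ p q, (p = a ∨ p = b ∨ p = c) ∧ (q = a' ∨ q = b' ∨ q = c') ∧
      bt d p u q ∧ bt d p v q ∧ ¬ bt d p w q := by
  obtain ⟨p, hp, hp1, hp2⟩ := med_dir h hu v w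
  obtain ⟨q, hq, hq1, hq2⟩ := med_dir h hv u w
  have hc := chain h hp1 (bt_symm h hq1) hne
  have hpu : bt d p u q := by
    have := h.three p u q
    have := h.three u v q
    unfold bt at *; omega
  have hpv : bt d p v q := by
    have := h.three p u v
    have := h.three p v q
    unfold bt at *; omega
  refine ⟨p, q, hp, hq, hpu, hpv, fun hb => hw ?_⟩
  have := h.four p q u w
  have := h.four p q v w
  have := h.four u v p w
  unfold bt at *
  have t1 := split h u hb
  have t2 := split h v hb
  unfold bt at *
  omega

/-- Separation in a tree via the kept vertices. -/
lemma not_bt_iff (h : TM d) {K : Set V} {u v w : V} (hu : u ∈ K) (hv : v ∈ K) (hw : w ∈ K)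
    (huw : u ≠ w) :
    (¬ bt d u w v) ↔ Relation.ReflTransGen (fun x y => radj d K x y ∧ y ≠ w) u v := by
  constructor
  · have key : ∀ k : ℕ, ∀ u v, d u v ≤ k → u ∈ K → v ∈ K → u ≠ w → v ≠ w → ¬ bt d u w v →
        Relation.ReflTransGen (fun x y => radj d K x y ∧ y ≠ w) u v := by
      intro k
      induction k with
      | zero =>
        intro u v hk _ _ _ _ _
        have := h.eq u v (by omega)
        subst this
        exact Relation.ReflTransGen.refl
      | succ k ih =>
        intro u v hk hu hv huw hvw hb
        by_cases huv : u = v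
        · subst huv; exact Relation.ReflTransGen.refl
        by_cases hr : radj d K u v
        · exact Relation.ReflTransGen.single ⟨hr, hvw⟩
        have : ∃ z ∈ K, bt d u z v ∧ z ≠ u ∧ z ≠ v := by
          by_contra hcon
          apply hr
          refine ⟨hu, hv, huv, fun z hz hbz => ?_⟩
          by_contra h2
          rw [not_or] at h2
          exact hcon ⟨z, hz, hbz, h2⟩
        obtain ⟨z, hz, hbz, hzu, hzv⟩ := this
        have p1 := h.pos hzu
        have p2 := h.pos hzv
        have t := h.three u z v
        have hzw : z ≠ w := by rintro rfl; exact hb hbz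
        have b1 : ¬ bt d u w z := fun hh => hb (bt_extend h hbz hh).1
        have b2 : ¬ bt d z w v := fun hh => hb
          (bt_symm h (bt_extend h (bt_symm h hbz) (bt_symm h hh)).1)
        unfold bt at hbz
        exact (ih u z (by omega) hu hz huw hzw b1).trans (ih z v (by omega) hz hv hzw hvw b2)
    intro hb
    have hvw : v ≠ w := by rintro rfl; exact hb (bt_right h _ _)
    exact key _ u v le_rfl hu hv huw hvw hb
  · intro hr
    have : ¬ bt d u w v ∧ v ≠ w := by
      induction hr with
      | refl => exact ⟨fun hb => huw (bt_self h hb).symm, huw⟩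
      | tail _ hxy ih =>
        rename_i x y _
        obtain ⟨i1, i2⟩ := ih hxy.1.1
        refine ⟨fun hb => ?_, hxy.2⟩
        rcases split h x hb with hb | hb
        · exact i1 hb
        · rcases hxy.1.2.2.2 w hw hb with e | e
          · exact i2 e.symm
          · exact hxy.2 e.symm
    exact this.1

end metric

section transfer
variable {V V' : Type} {d : V → V → ℕ} {d' : V' → V' → ℕ}

lemma bt_transfer (h : TM d) (h' : TM d') {K : Set V} {K' : Set V'} {φ : V → V'}
    (hφ : Set.BijOn φ K K')
    (hr : ∀ u v, u ∈ K → v ∈ K → (radj d K u v ↔ radj d' K' (φ u) (φ v)))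
    {u v w : V} (hu : u ∈ K) (hv : v ∈ K) (hw : w ∈ K) :
    bt d u w v ↔ bt d' (φ u) (φ w) (φ v) := by
  by_cases huw : u = w
  · subst huw
    exact ⟨fun _ => bt_left h' _ _, fun _ => bt_left h _ _⟩
  have huw' : φ u ≠ φ w := fun e => huw (hφ.injOn hu hw e)
  rw [← not_iff_not, not_bt_iff h hu hv hw huw,
    not_bt_iff h' (hφ.mapsTo hu) (hφ.mapsTo hv) (hφ.mapsTo hw) huw']
  constructor
  · intro hp
    have : ∀ y, Relation.ReflTransGen (fun x y => radj d K x y ∧ y ≠ w) u y →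
        Relation.ReflTransGen (fun x y => radj d' K' x y ∧ y ≠ φ w) (φ u) (φ y) := by
      intro y hy
      induction hy with
      | refl => exact Relation.ReflTransGen.refl
      | tail _ hxy ih =>
        refine ih.tail ⟨(hr _ _ hxy.1.1 hxy.1.2.1).1 hxy.1, fun e => hxy.2 ?_⟩
        exact hφ.injOn hxy.1.2.1 hw e
    exact this v hp
  · intro hp
    have : ∀ y', Relation.ReflTransGen (fun x y => radj d' K' x y ∧ y ≠ φ w) (φ u) y' →
        ∃ y ∈ K, φ y = y' ∧ Relation.ReflTransGen (fun x y => radj d K x y ∧ y ≠ w) u y := by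
      intro y' hy
      induction hy with
      | refl => exact ⟨u, hu, rfl, Relation.ReflTransGen.refl⟩
      | tail _ hxy ih =>
        obtain ⟨x, hx, hxe, hxp⟩ := ih
        obtain ⟨y, hy, hye⟩ := hφ.surjOn hxy.1.2.1
        refine ⟨y, hy, hye, hxp.tail ⟨?_, ?_⟩⟩
        · rw [hr x y hx hy, hxe, hye]; exact hxy.1
        · rintro rfl; exact hxy.2 hye.symm
    obtain ⟨y, hy, hye, hyp⟩ := this _ hp
    rwa [hφ.injOn hy hv hye] at hyp

lemma MM_transfer (h : TM d) (h' : TM d') {K : Set V} {K' : Set V'} {φ : V → V'}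
    (hφ : Set.BijOn φ K K')
    (hr : ∀ u v, u ∈ K → v ∈ K → (radj d K u v ↔ radj d' K' (φ u) (φ v)))
    {a b c e : V} (ha : a ∈ K) (hb : b ∈ K) (hc : c ∈ K) (he : e ∈ K)
    (hK : ∀ m, IsMed d m a b c → m ∈ K)
    (hK' : ∀ m, IsMed d' m (φ a) (φ b) (φ c) → m ∈ K') :
    MM d a b c e ↔ MM d' (φ a) (φ b) (φ c) (φ e) := by
  constructor
  · intro hm
    obtain ⟨w, hw1, hw2⟩ := MM_med h hm
    have hw := hK w hw1
    exact ⟨φ w, (bt_transfer h h' hφ hr ha hb hw).1 hw1.1,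
      (bt_transfer h h' hφ hr hc he hw).1 hw2⟩
  · intro hm
    obtain ⟨w', hw1, hw2⟩ := MM_med h' hm
    obtain ⟨w, hw, rfl⟩ := hφ.surjOn (hK' w' hw1)
    exact ⟨w, (bt_transfer h h' hφ hr ha hb hw).2 hw1.1,
      (bt_transfer h h' hφ hr hc he hw).2 hw2⟩

/-- The set of medians of labelled leaves. -/
def mk {X : Type} (d : V → V → ℕ) (l : X → V) (B : Set X) : Set V :=
  {m | ∃ a ∈ B, ∃ b ∈ B, ∃ c ∈ B, IsMed d m (l a) (l b) (l c)}

/-- Two labelled trees have the same quartets on `B`. -/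
def Agree {X : Type} (d : V → V → ℕ) (d' : V' → V' → ℕ) (l : X → V) (l' : X → V')
    (B : Set X) : Prop :=
  ∀ a ∈ B, ∀ b ∈ B, ∀ c ∈ B, ∀ e ∈ B,
    (MM d (l a) (l b) (l c) (l e) ↔ MM d' (l' a) (l' b) (l' c) (l' e))

/-- Corresponding medians. -/
def MRel {X : Type} (d : V → V → ℕ) (d' : V' → V' → ℕ) (l : X → V) (l' : X → V')
    (B : Set X) (m : V) (m' : V') : Prop :=
  ∃ a ∈ B, ∃ b ∈ B, ∃ c ∈ B, IsMed d m (l a) (l b) (l c) ∧ IsMed d' m' (l' a) (l' b) (l' c)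

variable {X : Type} {l : X → V} {l' : X → V'} {B : Set X}

lemma mrel_on (h : TM d) (h' : TM d') (hA : Agree d d' l l' B) {m : V} {m' : V'}
    (hm : MRel d d' l l' B m m') {p q : X} (hp : p ∈ B) (hq : q ∈ B) :
    bt d (l p) m (l q) ↔ bt d' (l' p) m' (l' q) := by
  obtain ⟨a, ha, b, hb, c, hc, h1, h2⟩ := hm
  rw [helly h h1, helly h' h2, hA a ha b hb p hp q hq, hA b hb c hc p hp q hq,
    hA a ha c hc p hp q hq]

lemma mrel_eq (h : TM d) (h' : TM d') (hA : Agree d d' l l' B) {m n : V} {m' n' : V'}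
    (hm : MRel d d' l l' B m m') (hn : MRel d d' l l' B n n') : m = n ↔ m' = n' := by
  obtain ⟨a, ha, b, hb, c, hc, h1, h2⟩ := hn
  constructor
  · rintro rfl
    refine med_unique h' ⟨?_, ?_, ?_⟩ h2
    · exact (mrel_on h h' hA hm ha hb).1 h1.1
    · exact (mrel_on h h' hA hm hb hc).1 h1.2.1
    · exact (mrel_on h h' hA hm ha hc).1 h1.2.2
  · rintro rfl
    refine med_unique h ⟨?_, ?_, ?_⟩ h1
    · exact (mrel_on h h' hA hm ha hb).2 h2.1
    · exact (mrel_on h h' hA hm hb hc).2 h2.2.1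
    · exact (mrel_on h h' hA hm ha hc).2 h2.2.2

lemma bt_iff_labels (h : TM d) {u v w : V} (hu : u ∈ mk d l B) (hv : v ∈ mk d l B)
    (hne : u ≠ v) :
    bt d u w v ↔ ∀ p ∈ B, ∀ q ∈ B, bt d (l p) u (l q) → bt d (l p) v (l q) →
      bt d (l p) w (l q) := by
  constructor
  · intro hb p _ q _ h1 h2
    exact bt_conv h h1 h2 hb
  · intro hall
    by_contra hw
    obtain ⟨a, ha, b, hb, c, hc, h1⟩ := hu
    obtain ⟨a', ha', b', hb', c', hc', h2⟩ := hv
    obtain ⟨p, q, hp, hq, e1, e2, e3⟩ := sep h h1 h2 hne hw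
    have hp' : ∃ x ∈ B, l x = p := by
      rcases hp with rfl | rfl | rfl
      · exact ⟨a, ha, rfl⟩
      · exact ⟨b, hb, rfl⟩
      · exact ⟨c, hc, rfl⟩
    have hq' : ∃ x ∈ B, l x = q := by
      rcases hq with rfl | rfl | rfl
      · exact ⟨a', ha', rfl⟩
      · exact ⟨b', hb', rfl⟩
      · exact ⟨c', hc', rfl⟩
    obtain ⟨x, hx, rfl⟩ := hp'
    obtain ⟨y, hy, rfl⟩ := hq'
    exact e3 (hall x hx y hy e1 e2)

lemma mrel_bt (h : TM d) (h' : TM d') (hA : Agree d d' l l' B) {u v w : V} {u' v' w' : V'}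
    (hu : MRel d d' l l' B u u') (hv : MRel d d' l l' B v v') (hw : MRel d d' l l' B w w')
    (hne : u ≠ v) : bt d u w v ↔ bt d' u' w' v' := by
  have hne' : u' ≠ v' := fun e => hne ((mrel_eq h h' hA hu hv).2 e)
  have k1 : ∀ {m m'}, MRel d d' l l' B m m' → m ∈ mk d l B := by
    rintro m m' ⟨a, ha, b, hb, c, hc, h1, h2⟩
    exact ⟨a, ha, b, hb, c, hc, h1⟩
  have k2 : ∀ {m m'}, MRel d d' l l' B m m' → m' ∈ mk d' l' B := by
    rintro m m' ⟨a, ha, b, hb, c, hc, h1, h2⟩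
    exact ⟨a, ha, b, hb, c, hc, h2⟩
  rw [bt_iff_labels h (k1 hu) (k1 hv) hne, bt_iff_labels h' (k2 hu) (k2 hv) hne']
  constructor
  · intro hh p hp q hq
    rw [← mrel_on h h' hA hu hp hq, ← mrel_on h h' hA hv hp hq, ← mrel_on h h' hA hw hp hq]
    exact hh p hp q hq
  · intro hh p hp q hq
    rw [mrel_on h h' hA hu hp hq, mrel_on h h' hA hv hp hq, mrel_on h h' hA hw hp hq]
    exact hh p hp q hq

lemma med_self (h : TM d) (a : V) : IsMed d a a a a := ⟨bt_left h _ _, bt_left h _ _, bt_left h _ _⟩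

lemma exists_iso [Nonempty V'] (h : TM d) (h' : TM d') (hA : Agree d d' l l' B) :
    ∃ φ : V → V', Set.BijOn φ (mk d l B) (mk d' l' B) ∧ (∀ x ∈ B, φ (l x) = l' x) ∧
      ∀ u v, u ∈ mk d l B → v ∈ mk d l B →
        (radj d (mk d l B) u v ↔ radj d' (mk d' l' B) (φ u) (φ v)) := by
  have hex : ∀ m : V, ∃ m' : V', m ∈ mk d l B → MRel d d' l l' B m m' := by
    intro m
    by_cases hm : m ∈ mk d l B
    · obtain ⟨a, ha, b, hb, c, hc, h1⟩ := hm
      obtain ⟨m', hm'⟩ := med_of h' (l' a) (l' b) (l' c)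
      exact ⟨m', fun _ => ⟨a, ha, b, hb, c, hc, h1, hm'⟩⟩
    · exact ⟨Classical.arbitrary V', fun hh => absurd hh hm⟩
  choose φ hφ using hex
  have hbij : Set.BijOn φ (mk d l B) (mk d' l' B) := by
    refine ⟨?_, ?_, ?_⟩
    · intro m hm
      obtain ⟨a, ha, b, hb, c, hc, h1, h2⟩ := hφ m hm
      exact ⟨a, ha, b, hb, c, hc, h2⟩
    · intro m hm n hn e
      exact (mrel_eq h h' hA (hφ m hm) (hφ n hn)).2 e
    · rintro m' ⟨a, ha, b, hb, c, hc, h2⟩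
      obtain ⟨m, hm⟩ := med_of h (l a) (l b) (l c)
      have hmk : m ∈ mk d l B := ⟨a, ha, b, hb, c, hc, hm⟩
      exact ⟨m, hmk, (mrel_eq h h' hA (hφ m hmk) ⟨a, ha, b, hb, c, hc, hm, h2⟩).1 rfl⟩
  refine ⟨φ, hbij, ?_, ?_⟩
  · intro x hx
    have hmk : l x ∈ mk d l B := ⟨x, hx, x, hx, x, hx, med_self h _⟩
    exact (mrel_eq h h' hA (hφ _ hmk)
      ⟨x, hx, x, hx, x, hx, med_self h _, med_self h' _⟩).1 rfl
  · intro u v hu hv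
    constructor
    · rintro ⟨_, _, hne, hall⟩
      refine ⟨hbij.mapsTo hu, hbij.mapsTo hv, fun e => hne (hbij.injOn hu hv e), ?_⟩
      intro w' hw' hb
      obtain ⟨w, hw, rfl⟩ := hbij.surjOn hw'
      rcases hall w hw ((mrel_bt h h' hA (hφ u hu) (hφ v hv) (hφ w hw) hne).2 hb) with e | e
      · exact Or.inl (by rw [e])
      · exact Or.inr (by rw [e])
    · rintro ⟨_, _, hne, hall⟩
      have hne' : u ≠ v := by rintro rfl; exact hne rfl
      refine ⟨hu, hv, hne', fun w hw hb => ?_⟩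
      rcases hall (φ w) (hbij.mapsTo hw)
        ((mrel_bt h h' hA (hφ u hu) (hφ v hv) (hφ w hw) hne').1 hb) with e | e
      · exact Or.inl (hbij.injOn hw hu e)
      · exact Or.inr (hbij.injOn hw hv e)

end transfer

section utree
variable {X : Type}

/-- The distance function of a phylogenetic tree. -/
noncomputable def D (T : UTree X) : T.V → T.V → ℕ := fun u v => T.g.dist u v

lemma tmD (T : UTree X) : TM (D T) := tm_dist T.isTree

lemma adj_iff (T : UTree X) {u v : T.V} : T.g.Adj u v ↔ D T u v = 1 :=
  SimpleGraph.dist_eq_one_iff_adj.symm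

lemma span_iff (T : UTree X) (B : Set X) (v : T.V) :
    v ∈ T.spanSet B ↔ ∃ x ∈ B, ∃ y ∈ B, bt (D T) (T.label x) v (T.label y) := by
  constructor
  · rintro ⟨x, hx, y, hy, p, hp, hv⟩
    exact ⟨x, hx, y, hy, bt_of_mem T.isTree p hp hv⟩
  · rintro ⟨x, hx, y, hy, hb⟩
    obtain ⟨p, hp, _⟩ := T.isTree.1.exists_path_of_dist (T.label x) (T.label y)
    exact ⟨x, hx, y, hy, p, hp, mem_of_bt T.isTree p hb⟩

lemma span_label (T : UTree X) {B : Set X} {x : X} (hx : x ∈ B) : T.label x ∈ T.spanSet B :=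
  (span_iff T B _).2 ⟨x, hx, x, hx, bt_left (tmD T) _ _⟩

lemma span_convex (T : UTree X) (B : Set X) {u v w : T.V} (hu : u ∈ T.spanSet B)
    (hv : v ∈ T.spanSet B) (hw : bt (D T) u w v) : w ∈ T.spanSet B := by
  have h := tmD T
  rw [span_iff] at *
  obtain ⟨a, ha, b, hb, hab⟩ := hu
  obtain ⟨c, hc, e, he, hce⟩ := hv
  rcases split h (T.label c) hw with h1 | h1
  · rcases split h (T.label a) h1 with h2 | h2
    · exact ⟨a, ha, b, hb, (bt_extend h hab (bt_symm h h2)).1⟩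
    · exact ⟨a, ha, c, hc, h2⟩
  · exact ⟨c, hc, e, he, (bt_extend h hce h1).1⟩

lemma span_dir (T : UTree X) {B : Set X} {n : T.V} (v : T.V) (hn : n ∈ T.spanSet B) :
    ∃ z ∈ B, bt (D T) v n (T.label z) := by
  have h := tmD T
  obtain ⟨x, hx, y, hy, hb⟩ := (span_iff T B _).1 hn
  rcases split h v hb with h1 | h1
  · exact ⟨x, hx, bt_symm h h1⟩
  · exact ⟨y, hy, h1⟩

/-- Different neighbours of a vertex are separated by it. -/
lemma nbr_dist {V : Type} {d : V → V → ℕ} (h : TM d) {v m n : V} (h1 : d v m = 1) (h2 : d v n = 1)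
    (hne : m ≠ n) : bt d m v n := by
  obtain ⟨w, hw1, hw2, hw3⟩ := med_of h v m n
  have := h.three v m n
  have := h.three v m w
  have := h.three v n w
  have := h.three m n w
  have := h.pos hne
  unfold bt at *; omega

lemma nbr_branch {V : Type} {d : V → V → ℕ} (h : TM d) {v m n y z : V} (h1 : d v m = 1)
    (h2 : d v n = 1) (hne : m ≠ n) (hy : bt d v m y) (hz : bt d v n z) : bt d y v z := by
  have b := nbr_dist h h1 h2 hne
  have hvm : v ≠ m := by rintro rfl; rw [h.self] at h1; omega
  have hvn : v ≠ n := by rintro rfl; rw [h.self] at h2; omega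
  have c1 := chain h (bt_symm h hy) b hvm.symm
  have := h.three y m v
  have := h.three y v n
  have := h.three y m n
  have b2 : bt d y v n := by unfold bt at *; omega
  have c2 := chain h b2 hz hvn
  have := h.three v n z
  unfold bt at *; omega

lemma keep_eq (T : UTree X) (B : Set X) : T.keepSet B = mk (D T) T.label B := by
  have h := tmD T
  have := T.finV
  ext v
  constructor
  · rintro ⟨hv, ⟨x, hx, rfl⟩ | hc⟩
    · exact ⟨x, hx, x, hx, x, hx, med_self h _⟩
    · have hc' : 2 < (T.g.neighborSet v ∩ T.spanSet B).ncard := hc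
      rw [Set.two_lt_ncard_iff (Set.toFinite _)] at hc'
      obtain ⟨n1, n2, n3, hn1, hn2, hn3, h12, h13, h23⟩ := hc'
      obtain ⟨z1, hz1, b1⟩ := span_dir T v hn1.2
      obtain ⟨z2, hz2, b2⟩ := span_dir T v hn2.2
      obtain ⟨z3, hz3, b3⟩ := span_dir T v hn3.2
      have a1 := (adj_iff T).1 hn1.1
      have a2 := (adj_iff T).1 hn2.1
      have a3 := (adj_iff T).1 hn3.1
      exact ⟨z1, hz1, z2, hz2, z3, hz3, nbr_branch h a1 a2 h12 b1 b2,
        nbr_branch h a2 a3 h23 b2 b3, nbr_branch h a1 a3 h13 b1 b3⟩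
  · rintro ⟨a, ha, b, hb, c, hc, m1, m2, m3⟩
    refine ⟨(span_iff T B v).2 ⟨a, ha, b, hb, m1⟩, ?_⟩
    by_cases hl : v ∈ T.label '' B
    · exact Or.inl hl
    right
    have hne : ∀ x ∈ B, v ≠ T.label x := fun x hx e => hl ⟨x, hx, e.symm⟩
    obtain ⟨n1, d1, e1⟩ := h.nbr v _ (hne a ha)
    obtain ⟨n2, d2, e2⟩ := h.nbr v _ (hne b hb)
    obtain ⟨n3, d3, e3⟩ := h.nbr v _ (hne c hc)
    have hdist : ∀ {x y n : T.V}, bt (D T) x v y → D T v n = 1 → D T n x + 1 = D T v x →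
        D T n y + 1 = D T v y → False := by
      intro x y n h1 h2 h3 h4
      have := h.three x y n
      have := h.three x y v
      have := h.three x n v
      unfold bt at *; omega
    have hsp : ∀ {x y n : T.V}, bt (D T) x v y → D T v n = 1 → D T n x + 1 = D T v x →
        bt (D T) x n y := by
      intro x y n h1 h2 h3
      have := h.three x y n
      have := h.three x y v
      have := h.three x n v
      have := h.three y n v
      unfold bt at *; omega
    show 2 < (T.g.neighborSet v ∩ T.spanSet B).ncard
    rw [Set.two_lt_ncard_iff (Set.toFinite _)]
    refine ⟨n1, n2, n3, ⟨(adj_iff T).2 d1, ?_⟩, ⟨(adj_iff T).2 d2, ?_⟩, ⟨(adj_iff T).2 d3, ?_⟩,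
      ?_, ?_, ?_⟩
    · exact (span_iff T B _).2 ⟨a, ha, b, hb, hsp m1 d1 e1⟩
    · exact (span_iff T B _).2 ⟨b, hb, c, hc, hsp m2 d2 e2⟩
    · exact (span_iff T B _).2 ⟨c, hc, b, hb, hsp (bt_symm h m2) d3 e3⟩
    · rintro rfl; exact hdist m1 d1 e1 e2
    · rintro rfl; exact hdist m3 d1 e1 e3
    · rintro rfl; exact hdist m2 d2 e2 e3

lemma keep_sub_span (T : UTree X) (B : Set X) : T.keepSet B ⊆ T.spanSet B := fun _ h => h.1

lemma restAdj_iff (T : UTree X) (B : Set X) (u v : T.V) :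
    T.restAdj B u v ↔ radj (D T) (mk (D T) T.label B) u v := by
  rw [← keep_eq]
  constructor
  · rintro ⟨hu, hv, hne, p, hp, h1, h2⟩
    exact ⟨hu, hv, hne, fun w hw hb => h2 w (mem_of_bt T.isTree p hb) hw⟩
  · rintro ⟨hu, hv, hne, hall⟩
    obtain ⟨p, hp, _⟩ := T.isTree.1.exists_path_of_dist u v
    refine ⟨hu, hv, hne, p, hp, fun w hw => ?_, fun w hw hk => ?_⟩
    · exact span_convex T B hu.1 hv.1 (bt_of_mem T.isTree p hp hw)
    · exact hall w hk (bt_of_mem T.isTree p hp hw)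

lemma label_mk (T : UTree X) {B : Set X} {x : X} (hx : x ∈ B) :
    T.label x ∈ mk (D T) T.label B := ⟨x, hx, x, hx, x, hx, med_self (tmD T) _⟩

/-- Quartet characterization of `T|B = T'|B`. -/
lemma restEq_iff (T T' : UTree X) (B : Set X) :
    UTree.restEq T T' B ↔ Agree (D T) (D T') T.label T'.label B := by
  unfold UTree.restEq
  simp only [restAdj_iff, keep_eq]
  constructor
  · rintro ⟨φ, h1, h2, h3⟩ a ha b hb c hc e he
    rw [← h2 a ha, ← h2 b hb, ← h2 c hc, ← h2 e he]
    apply MM_transfer (tmD T) (tmD T') h1 h3 (label_mk T ha) (label_mk T hb) (label_mk T hc)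
      (label_mk T he)
    · intro m hm
      exact ⟨a, ha, b, hb, c, hc, hm⟩
    · intro m hm
      rw [h2 a ha, h2 b hb, h2 c hc] at hm
      exact ⟨a, ha, b, hb, c, hc, hm⟩
  · intro hA
    have : Nonempty T'.V := T'.isTree.1.nonempty
    exact exists_iso (tmD T) (tmD T') hA

lemma radj_univ (T : UTree X) (u v : T.V) : radj (D T) Set.univ u v ↔ T.g.Adj u v := by
  have h := tmD T
  rw [adj_iff]
  constructor
  · rintro ⟨_, _, hne, hall⟩
    obtain ⟨n, h1, h2⟩ := h.nbr u v hne
    rcases hall n trivial (by unfold bt; omega) with rfl | rfl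
    · rw [h.self] at h1; omega
    · exact h1
  · intro h1
    refine ⟨trivial, trivial, ?_, fun w _ hb => ?_⟩
    · rintro rfl; rw [h.self] at h1; omega
    · unfold bt at hb
      by_cases h0 : D T u w = 0
      · exact Or.inl (h.eq _ _ h0).symm
      · exact Or.inr (h.eq _ _ (by omega))

lemma restriction_MM (T : UTree X) (X' : Set X) (T' : UTree X') (hR : UTree.IsRestrictionOf T X' T')
    (a b c e : X') :
    MM (D T') (T'.label a) (T'.label b) (T'.label c) (T'.label e) ↔
      MM (D T) (T.label a) (T.label b) (T.label c) (T.label e) := by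
  obtain ⟨φ, hinj, hl, hrange, hadj⟩ := hR
  rw [keep_eq] at hrange
  have hbij : Set.BijOn φ Set.univ (mk (D T) T.label X') := by
    rw [← hrange, ← Set.image_univ]
    exact hinj.injOn.bijOn_image
  rw [← hl, ← hl, ← hl, ← hl]
  apply MM_transfer (tmD T') (tmD T) hbij _ trivial trivial trivial trivial
  · intros; trivial
  · intro m hm
    rw [hl, hl, hl] at hm
    exact ⟨a, a.2, b, b.2, c, c.2, hm⟩
  · intro u v _ _
    rw [radj_univ, hadj, restAdj_iff]

lemma disjoint_iff (T : UTree X) (B C : Set X) :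
    Disjoint (T.spanSet B) (T.spanSet C) ↔ ∀ a ∈ B, ∀ b ∈ B, ∀ c ∈ C, ∀ e ∈ C,
      ¬ MM (D T) (T.label a) (T.label b) (T.label c) (T.label e) := by
  rw [Set.disjoint_left]
  constructor
  · rintro h a ha b hb c hc e he ⟨w, h1, h2⟩
    exact h ((span_iff T B w).2 ⟨a, ha, b, hb, h1⟩) ((span_iff T C w).2 ⟨c, hc, e, he, h2⟩)
  · intro h w h1 h2
    obtain ⟨a, ha, b, hb, h1⟩ := (span_iff T B w).1 h1
    obtain ⟨c, hc, e, he, h2⟩ := (span_iff T C w).1 h2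
    exact h a ha b hb c hc e he ⟨w, h1, h2⟩

/-- There is a leaf beyond every directed edge. -/
lemma leaf_beyond (T : UTree X) {x w : T.V} (hxw : D T x w = 1) :
    ∃ z : X, bt (D T) x w (T.label z) := by
  have h := tmD T
  have := T.finV
  obtain ⟨z, hz, hmax⟩ := Set.exists_max_image {z | bt (D T) x w z} (fun z => D T x z)
    (Set.toFinite _) ⟨w, bt_right h _ _⟩
  by_cases hl : z ∈ Set.range T.label
  · obtain ⟨y, rfl⟩ := hl
    exact ⟨y, hz⟩
  exfalso
  have h3 := T.internal_deg z hl
  have hc' : 2 < (T.g.neighborSet z).ncard := by omega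
  rw [Set.two_lt_ncard_iff (Set.toFinite _)] at hc'
  obtain ⟨n1, n2, n3, hn1, hn2, hn3, h12, h13, h23⟩ := hc'
  have a1 := (adj_iff T).1 hn1
  have a2 := (adj_iff T).1 hn2
  have key : ∃ n, D T z n = 1 ∧ D T x n = D T x z + 1 := by
    have b := nbr_dist h a1 a2 h12
    have b1 := split h x b
    by_cases hh : D T x n1 = D T x z + 1
    · exact ⟨n1, a1, hh⟩
    · refine ⟨n2, a2, ?_⟩
      have := h.three x z n1
      have := h.three x z n2
      unfold bt at *; omega
  obtain ⟨n, k1, k2⟩ := key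
  have : bt (D T) x w n := by
    have := h.three x w n
    have := h.three x z n
    have := h.three w z n
    have := h.three x w z
    have hz' : bt (D T) x w z := hz
    unfold bt at *; omega
  have := hmax n this
  omega

end utree

section pendant
variable {X : Type}

/-- The quartet relation of a tree on its labels. -/
def Q (T : UTree X) (a b c e : X) : Prop :=
  MM (D T) (T.label a) (T.label b) (T.label c) (T.label e)

/-- `(u, v)` is a pendant edge for `S`, in terms of distances. -/
structure Pend (T : UTree X) (S : Set X) (u v : T.V) : Prop where
  adj : D T u v = 1
  ins : ∀ x, x ∈ S → bt (D T) (T.label x) u v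
  outs : ∀ x, x ∉ S → bt (D T) (T.label x) v u

lemma dicho {V : Type} {d : V → V → ℕ} (h : TM d) {u v : V} (h1 : d u v = 1) (z : V) :
    bt d z u v ∨ bt d z v u := by
  obtain ⟨m, h2, h3, h4⟩ := med_of h z u v
  have := h.three u v m
  have := h.three z u v
  unfold bt at *
  by_cases h0 : d u m = 0
  · have := h.eq _ _ h0; subst this; left; omega
  · have := h.eq m v (by omega); subst this; right; omega

lemma not_both {V : Type} {d : V → V → ℕ} (h : TM d) {u v : V} (h1 : d u v = 1) {z : V}
    (h2 : bt d z u v) (h3 : bt d z v u) : False := by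
  have := h.three u v z
  unfold bt at *; omega

/-- Only the pendant edge crosses between the two sides. -/
lemma cross {V : Type} {d : V → V → ℕ} (h : TM d) {u v z w : V} (h1 : d u v = 1)
    (h2 : d z w = 1) (h3 : bt d z u v) (h4 : bt d w v u) : z = u ∧ w = v := by
  have := h.four u v z w
  unfold bt at *
  exact ⟨h.eq _ _ (by omega), h.eq _ _ (by omega)⟩

lemma pend_of (T : UTree X) (S : Set X) (hp : UTree.IsPendant T S) : ∃ u v, Pend T S u v := by
  obtain ⟨u, v, hadj, hx⟩ := hp
  have h := tmD T
  have h1 := (adj_iff T).1 hadj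
  have key : ∀ z, (T.g.deleteEdges {s(u, v)}).Reachable u z ↔ bt (D T) z u v := by
    intro z
    constructor
    · intro hr
      rw [SimpleGraph.reachable_iff_reflTransGen] at hr
      induction hr with
      | refl => exact bt_left h _ _
      | tail _ hxy ih =>
        rename_i x y _
        rw [SimpleGraph.deleteEdges_adj] at hxy
        rcases dicho h h1 y with hh | hh
        · exact hh
        · exfalso
          obtain ⟨rfl, rfl⟩ := cross h h1 ((adj_iff T).1 hxy.1) ih hh
          exact hxy.2 rfl
    · have : ∀ k : ℕ, ∀ z, D T z u = k → bt (D T) z u v →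
          (T.g.deleteEdges {s(u, v)}).Reachable u z := by
        intro k
        induction k with
        | zero =>
          intro z hz _
          have := h.eq _ _ hz
          subst this
          exact SimpleGraph.Reachable.refl _
        | succ k ih =>
          intro z hz hb
          have hzu : z ≠ u := by rintro rfl; rw [h.self] at hz; omega
          have hzv : z ≠ v := by rintro rfl; exact hzu.symm (bt_self h hb)
          obtain ⟨n, n1, n2⟩ := h.nbr z u hzu
          have hbn : bt (D T) n u v := by
            have := h.three n u v
            have := h.three z n v
            have := h.three z u v
            unfold bt at *; omega
          refine (ih n (by omega) hbn).trans (SimpleGraph.Adj.reachable ?_)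
          rw [SimpleGraph.deleteEdges_adj]
          refine ⟨((adj_iff T).2 n1).symm, ?_⟩
          intro he
          rw [Set.mem_singleton_iff, Sym2.eq_iff] at he
          rcases he with ⟨_, e⟩ | ⟨_, e⟩
          · exact hzv e
          · exact hzu e
      exact this _ z rfl
  refine ⟨u, v, h1, fun x hxS => (key _).1 ((hx x).2 hxS), fun x hxS => ?_⟩
  rcases dicho h h1 (T.label x) with hh | hh
  · exact absurd ((hx x).1 ((key _).2 hh)) hxS
  · exact hh

lemma pend_mem {T : UTree X} {S : Set X} {u v : T.V} (hp : Pend T S u v) {x : X}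
    (hx : bt (D T) (T.label x) u v) : x ∈ S := by
  by_contra hn
  exact not_both (tmD T) hp.adj hx (hp.outs x hn)

lemma pend_dist {T : UTree X} {S : Set X} {u v : T.V} (hp : Pend T S u v) {a c : X}
    (ha : a ∈ S) (hc : c ∉ S) :
    D T (T.label a) (T.label c) = D T (T.label a) u + 1 + D T (T.label c) v := by
  have h := tmD T
  have hne : u ≠ v := by
    rintro rfl
    have := hp.adj
    rw [h.self] at this; omega
  have := chain h (hp.ins a ha) (bt_symm h (hp.outs c hc)) hne
  rw [this, hp.adj, h.symm v]

/-- Quartet properties of a tree with a pendant subtree on `S`. -/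
structure QP (M : X → X → X → X → Prop) (S : Set X) : Prop where
  sw1 : ∀ a b c e, M a b c e ↔ M b a c e
  sw2 : ∀ a b c e, M a b c e ↔ M a b e c
  sw3 : ∀ a b c e, M a b c e ↔ M c e a b
  p1 : ∀ a b c e, a ∈ S → b ∈ S → c ∉ S → e ∉ S → ¬ M a b c e
  p2 : ∀ a b c e, a ∈ S → b ∉ S → c ∈ S → e ∉ S → M a b c e
  r : ∀ x y b c e, x ∈ S → y ∈ S → b ∉ S → c ∉ S → e ∉ S → (M x b c e ↔ M y b c e)

lemma qp_of {T : UTree X} {S : Set X} {u v : T.V} (hp : Pend T S u v) : QP (Q T) S where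
  sw1 := fun a b c e => MM_swap1 (tmD T)
  sw2 := fun a b c e => MM_swap2 (tmD T)
  sw3 := fun a b c e => MM_swap3
  p1 := fun a b c e ha hb hc he => by
    have h := tmD T
    unfold Q
    rw [MM_iff_le h, pend_dist hp ha hc, pend_dist hp hb he]
    have := h.three (T.label a) (T.label b) u
    have := h.three (T.label c) (T.label e) v
    omega
  p2 := fun a b c e ha hb hc he => by
    have h := tmD T
    have key : ∀ x y, x ∈ S → y ∉ S → bt (D T) (T.label x) u (T.label y) := by
      intro x y hx hy
      have := pend_dist hp hx hy
      have := hp.outs y hy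
      have := h.three (T.label y) u v
      have := hp.adj
      unfold bt at *; omega
    exact ⟨u, key a b ha hb, key c e hc he⟩
  r := fun x y b c e hx hy hb hc he => by
    have h := tmD T
    unfold Q
    rw [MM_iff_le h, MM_iff_le h, pend_dist hp hx hc, pend_dist hp hx hb, pend_dist hp hy hc,
      pend_dist hp hy hb]
    omega

lemma q_three {T : UTree X} {S : Set X} {u v : T.V} (hp : Pend T S u v) {a b c e : X}
    (ha : a ∈ S) (hb : b ∈ S) (hc : c ∈ S) (he : e ∉ S) :
    Q T a b c e ↔ MM (D T) (T.label a) (T.label b) (T.label c) u := by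
  have h := tmD T
  unfold Q
  rw [MM_iff_le h, MM_iff_le h, pend_dist hp hb he, pend_dist hp hc he]
  omega

lemma side_span {T : UTree X} {S : Set X} {u v : T.V} (hp : Pend T S u v) {w : T.V}
    (hw : w ∈ T.spanSet S) : bt (D T) w u v := by
  have h := tmD T
  obtain ⟨x, hx, y, hy, hb⟩ := (span_iff T S w).1 hw
  have h1 := hp.ins x hx
  have h2 := hp.ins y hy
  have h0 := hp.adj
  have := h.four u v w (T.label x)
  have := h.four u v w (T.label y)
  have := h.three (T.label x) (T.label y) u
  have := h.three (T.label x) (T.label y) w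
  rcases dicho h h0 w with hh | hh
  · exact hh
  · exfalso
    unfold bt at *; omega

lemma u_span {T : UTree X} {S : Set X} {u v : T.V} (hp : Pend T S u v) : u ∈ T.spanSet S := by
  have h := tmD T
  have := T.finV
  by_cases hl : u ∈ Set.range T.label
  · obtain ⟨x, rfl⟩ := hl
    exact span_label T (pend_mem hp (bt_left h _ _))
  have h3 := T.internal_deg u hl
  have hvm : v ∈ T.g.neighborSet u := (adj_iff T).2 hp.adj
  have hc : 1 < (T.g.neighborSet u \ {v}).ncard := by
    rw [Set.ncard_sdiff_singleton_of_mem hvm]; omega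
  rw [Set.one_lt_ncard_iff (Set.toFinite _)] at hc
  obtain ⟨n1, n2, hn1, hn2, hne⟩ := hc
  have a1 := (adj_iff T).1 hn1.1
  have a2 := (adj_iff T).1 hn2.1
  obtain ⟨z1, b1⟩ := leaf_beyond T a1
  obtain ⟨z2, b2⟩ := leaf_beyond T a2
  have hz1 : z1 ∈ S := pend_mem hp (nbr_branch h a1 hp.adj hn1.2 b1 (bt_right h _ _))
  have hz2 : z2 ∈ S := pend_mem hp (nbr_branch h a2 hp.adj hn2.2 b2 (bt_right h _ _))
  exact (span_iff T S u).2 ⟨z1, hz1, z2, hz2, nbr_branch h a1 a2 hne b1 b2⟩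

lemma attach_u {T : UTree X} {S : Set X} {u v : T.V} (hp : Pend T S u v) :
    UTree.attachPoint T S u :=
  ⟨u_span hp, v, fun hv => not_both (tmD T) hp.adj (side_span hp hv) (bt_left (tmD T) _ _),
    (adj_iff T).2 hp.adj⟩

lemma attach_unique {T : UTree X} {S : Set X} {u v : T.V} (hp : Pend T S u v) {x : T.V}
    (hx : UTree.attachPoint T S x) : x = u := by
  have h := tmD T
  obtain ⟨hxs, w, hw, hadj⟩ := hx
  have hxw := (adj_iff T).1 hadj
  have hxu := side_span hp hxs
  rcases dicho h hp.adj w with hh | hh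
  · exfalso
    apply hw
    rcases dicho h hxw u with h1 | h1
    · obtain ⟨z, hz⟩ := leaf_beyond T hxw
      have hne : x ≠ w := by rintro rfl; rw [h.self] at hxw; omega
      have hc := chain h h1 hz hne
      have hzS : z ∈ S := by
        apply pend_mem hp
        rcases dicho h hp.adj (T.label z) with h2 | h2
        · exact h2
        · exfalso
          have := h.four u v x (T.label z)
          have := h.four u v w (T.label z)
          have := h.three u x w
          have := h.three x w (T.label z)
          have := hp.adj
          unfold bt at *; omega
      exact span_convex T S hxs (span_label T hzS) hz
    · exact span_convex T S (u_span hp) hxs h1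
  · exact (cross h hp.adj hxw hxu hh).1

lemma radj_span (T : UTree X) (S : Set X) {u v : T.V} (hu : u ∈ T.spanSet S)
    (hv : v ∈ T.spanSet S) : radj (D T) (T.spanSet S) u v ↔ T.g.Adj u v := by
  have h := tmD T
  rw [← radj_univ]
  constructor
  · rintro ⟨_, _, hne, hall⟩
    exact ⟨trivial, trivial, hne, fun w _ hb => hall w (span_convex T S hu hv hb) hb⟩
  · rintro ⟨_, _, hne, hall⟩
    exact ⟨hu, hv, hne, fun w _ hb => hall w trivial hb⟩

lemma p3_of {T T' : UTree X} {S : Set X} {u v : T.V} {u' v' : T'.V} (hp : Pend T S u v)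
    (hp' : Pend T' S u' v') (hiso : UTree.pendantIso T T' S) {a b c : X} (e : X)
    (ha : a ∈ S) (hb : b ∈ S) (hc : c ∈ S) : Q T a b c e ↔ Q T' a b c e := by
  obtain ⟨φ, hbij, hl, hadj, hatt⟩ := hiso
  have hu : φ u = u' := attach_unique hp' (hatt u (attach_u hp))
  have key : ∀ y ∈ T.spanSet S, (MM (D T) (T.label a) (T.label b) (T.label c) y ↔
      MM (D T') (T'.label a) (T'.label b) (T'.label c) (φ y)) := by
    intro y hy
    rw [← hl a ha, ← hl b hb, ← hl c hc]
    apply MM_transfer (tmD T) (tmD T') hbij _ (span_label T ha) (span_label T hb)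
      (span_label T hc) hy
    · intro m hm
      exact (span_iff T S m).2 ⟨a, ha, b, hb, hm.1⟩
    · intro m hm
      rw [hl a ha, hl b hb] at hm
      exact (span_iff T' S m).2 ⟨a, ha, b, hb, hm.1⟩
    · intro x y hx hy
      rw [radj_span T S hx hy, radj_span T' S (hbij.mapsTo hx) (hbij.mapsTo hy), hadj x y hx hy]
  by_cases he : e ∈ S
  · unfold Q
    rw [key _ (span_label T he), hl e he]
  · rw [q_three hp ha hb hc he, q_three hp' ha hb hc he, key _ (u_span hp), hu]

/-- Agreement on a block depends only on the block outside `S`. -/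
lemma agree_change {M M' : X → X → X → X → Prop} {S : Set X} (h : QP M S) (h' : QP M' S)
    (h3 : ∀ a b c e, a ∈ S → b ∈ S → c ∈ S → (M a b c e ↔ M' a b c e))
    {B C : Set X} {t : X} (ht : t ∈ S) (htB : t ∈ B) (hC : ∀ x ∈ C, x ∉ S → x ∈ B)
    (hB : ∀ a ∈ B, ∀ b ∈ B, ∀ c ∈ B, ∀ e ∈ B, (M a b c e ↔ M' a b c e)) :
    ∀ a ∈ C, ∀ b ∈ C, ∀ c ∈ C, ∀ e ∈ C, (M a b c e ↔ M' a b c e) := by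
  have one : ∀ x ∈ S, ∀ b ∈ C, ∀ c ∈ C, ∀ e ∈ C, b ∉ S → c ∉ S → e ∉ S →
      (M x b c e ↔ M' x b c e) := by
    intro x hx b hb c hc e he hbS hcS heS
    rw [h.r x t b c e hx ht hbS hcS heS, h'.r x t b c e hx ht hbS hcS heS]
    exact hB t htB b (hC b hb hbS) c (hC c hc hcS) e (hC e he heS)
  have p1 : ∀ a b c e, a ∈ S → b ∈ S → c ∉ S → e ∉ S → (M a b c e ↔ M' a b c e) :=
    fun a b c e k1 k2 k3 k4 => iff_of_false (h.p1 a b c e k1 k2 k3 k4) (h'.p1 a b c e k1 k2 k3 k4)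
  have p2 : ∀ a b c e, a ∈ S → b ∉ S → c ∈ S → e ∉ S → (M a b c e ↔ M' a b c e) :=
    fun a b c e k1 k2 k3 k4 => iff_of_true (h.p2 a b c e k1 k2 k3 k4) (h'.p2 a b c e k1 k2 k3 k4)
  intro a ha b hb c hc e he
  by_cases aS : a ∈ S <;> by_cases bS : b ∈ S <;> by_cases cS : c ∈ S <;> by_cases eS : e ∈ S
  · exact h3 _ _ _ _ aS bS cS
  · exact h3 _ _ _ _ aS bS cS
  · rw [h.sw2, h'.sw2]; exact h3 _ _ _ _ aS bS eS
  · exact p1 _ _ _ _ aS bS cS eS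
  · rw [h.sw3, h'.sw3]; exact h3 _ _ _ _ cS eS aS
  · exact p2 _ _ _ _ aS bS cS eS
  · rw [h.sw2, h'.sw2]; exact p2 _ _ _ _ aS bS eS cS
  · exact one a aS b hb c hc e he bS cS eS
  · rw [h.sw3, h'.sw3, h.sw2, h'.sw2]; exact h3 _ _ _ _ cS eS bS
  · rw [h.sw1, h'.sw1]; exact p2 _ _ _ _ bS aS cS eS
  · rw [h.sw1, h'.sw1, h.sw2, h'.sw2]; exact p2 _ _ _ _ bS aS eS cS
  · rw [h.sw1, h'.sw1]; exact one b bS a ha c hc e he aS cS eS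
  · rw [h.sw3, h'.sw3]; exact p1 _ _ _ _ cS eS aS bS
  · rw [h.sw3, h'.sw3]; exact one c cS e he a ha b hb eS aS bS
  · rw [h.sw3, h'.sw3, h.sw1, h'.sw1]; exact one e eS c hc a ha b hb cS aS bS
  · exact hB a (hC a ha aS) b (hC b hb bS) c (hC c hc cS) e (hC e he eS)

lemma disj_change {M : X → X → X → X → Prop} {S : Set X} (h : QP M S)
    {B C E : Set X} {t : X} (ht : t ∈ S) (htB : t ∈ B) (hC : ∀ x ∈ C, x ∉ S → x ∈ B)
    (hE : ∀ x ∈ E, x ∉ S)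
    (hB : ∀ a ∈ B, ∀ b ∈ B, ∀ c ∈ E, ∀ e ∈ E, ¬ M a b c e) :
    ∀ a ∈ C, ∀ b ∈ C, ∀ c ∈ E, ∀ e ∈ E, ¬ M a b c e := by
  intro a ha b hb c hc e he
  have cS := hE c hc
  have eS := hE e he
  by_cases aS : a ∈ S <;> by_cases bS : b ∈ S
  · exact h.p1 _ _ _ _ aS bS cS eS
  · rw [h.r a t b c e aS ht bS cS eS]
    exact hB t htB b (hC b hb bS) c hc e he
  · rw [h.sw1, h.r b t a c e bS ht aS cS eS]
    exact hB t htB a (hC a ha aS) c hc e he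
  · exact hB a (hC a ha aS) b (hC b hb bS) c hc e he

end pendant

section final
variable {X : Type}

lemma forest_iff (𝒯 : Set (UTree X)) (F : Set (Set X)) :
    UTree.IsAgreementForest 𝒯 F ↔ UTree.IsForestPartition F ∧
      (∀ B ∈ F, ∀ T ∈ 𝒯, ∀ T' ∈ 𝒯, ∀ a ∈ B, ∀ b ∈ B, ∀ c ∈ B, ∀ e ∈ B,
        (Q T a b c e ↔ Q T' a b c e)) ∧
      (∀ B ∈ F, ∀ B' ∈ F, B ≠ B' → ∀ T ∈ 𝒯, ∀ a ∈ B, ∀ b ∈ B, ∀ c ∈ B', ∀ e ∈ B',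
        ¬ Q T a b c e) := by
  unfold UTree.IsAgreementForest
  simp only [restEq_iff, disjoint_iff]
  rfl

lemma q_rest {T : UTree X} {X' : Set X} {T' : UTree X'} (hR : UTree.IsRestrictionOf T X' T')
    (a b c e : X') : Q T' a b c e ↔ Q T a b c e := restriction_MM T X' T' hR a b c e

lemma forward [Finite X] (𝒯 : Set (UTree X)) (S : Set X) (s : X) (hs : s ∈ S)
    (hQP : ∀ T ∈ 𝒯, QP (Q T) S)
    (h3 : ∀ T ∈ 𝒯, ∀ T' ∈ 𝒯, ∀ a b c e, a ∈ S → b ∈ S → c ∈ S → (Q T a b c e ↔ Q T' a b c e))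
    (𝒯S : Set (UTree ↥(Sᶜ ∪ {s} : Set X)))
    (hres : UTree.IsRestrictionFamily 𝒯 (Sᶜ ∪ {s}) 𝒯S)
    (F : Set (Set ↥(Sᶜ ∪ {s} : Set X))) (hF : UTree.IsAgreementForest 𝒯S F) :
    ∃ F', UTree.IsAgreementForest 𝒯 F' ∧ F'.ncard ≤ F.ncard := by
  classical
  rw [forest_iff] at hF
  obtain ⟨⟨hne, huniq⟩, hag, hdis⟩ := hF
  let sX : ↥(Sᶜ ∪ {s} : Set X) := ⟨s, Or.inr rfl⟩
  let r : X → ↥(Sᶜ ∪ {s} : Set X) := fun x => if h : x ∈ S then sX else ⟨x, Or.inl h⟩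
  have rS : ∀ x ∈ S, r x = sX := fun x hx => by simp [r, hx]
  have rN : ∀ x, x ∉ S → (r x).1 = x := fun x hx => by simp [r, hx]
  have rsurj : Function.Surjective r := by
    rintro ⟨x, hx⟩
    by_cases hxS : x ∈ S
    · rcases hx with hx | hx
      · exact absurd hxS hx
      · have : x = s := hx
        subst this
        exact ⟨x, rS x hxS⟩
    · exact ⟨x, Subtype.ext (rN x hxS)⟩
  have hag' : ∀ B ∈ F, ∀ T ∈ 𝒯, ∀ T' ∈ 𝒯, ∀ a ∈ Subtype.val '' B, ∀ b ∈ Subtype.val '' B,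
      ∀ c ∈ Subtype.val '' B, ∀ e ∈ Subtype.val '' B, (Q T a b c e ↔ Q T' a b c e) := by
    rintro B hB T hT T' hT' _ ⟨a, ha, rfl⟩ _ ⟨b, hb, rfl⟩ _ ⟨c, hc, rfl⟩ _ ⟨e, he, rfl⟩
    obtain ⟨R, hR, hRT⟩ := hres.2 T hT
    obtain ⟨R', hR', hRT'⟩ := hres.2 T' hT'
    rw [← q_rest hRT, ← q_rest hRT']
    exact hag B hB R hR R' hR' a ha b hb c hc e he
  have hdis' : ∀ B ∈ F, ∀ B' ∈ F, B ≠ B' → ∀ T ∈ 𝒯, ∀ a ∈ Subtype.val '' B,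
      ∀ b ∈ Subtype.val '' B, ∀ c ∈ Subtype.val '' B', ∀ e ∈ Subtype.val '' B',
      ¬ Q T a b c e := by
    rintro B hB B' hB' hBB T hT _ ⟨a, ha, rfl⟩ _ ⟨b, hb, rfl⟩ _ ⟨c, hc, rfl⟩ _ ⟨e, he, rfl⟩
    obtain ⟨R, hR, hRT⟩ := hres.2 T hT
    rw [← q_rest hRT]
    exact hdis B hB B' hB' hBB R hR a ha b hb c hc e he
  have hin : ∀ B : Set ↥(Sᶜ ∪ {s} : Set X), ∀ x ∈ r ⁻¹' B, x ∉ S → x ∈ Subtype.val '' B :=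
    fun B x hx hxS => ⟨r x, hx, rN x hxS⟩
  have hsv : ∀ B : Set ↥(Sᶜ ∪ {s} : Set X), sX ∈ B → s ∈ Subtype.val '' B :=
    fun B hB => ⟨sX, hB, rfl⟩
  have hno : ∀ B : Set ↥(Sᶜ ∪ {s} : Set X), sX ∉ B → ∀ x ∈ r ⁻¹' B, x ∉ S := by
    intro B hB x hx hxS
    apply hB
    rw [← rS x hxS]; exact hx
  refine ⟨(fun B => r ⁻¹' B) '' F, ?_, Set.ncard_image_le (Set.toFinite _)⟩
  rw [forest_iff]
  refine ⟨⟨?_, ?_⟩, ?_, ?_⟩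
  · rintro _ ⟨B, hB, rfl⟩
    exact (hne B hB).preimage rsurj
  · intro x
    obtain ⟨B, ⟨hB, hxB⟩, hu⟩ := huniq (r x)
    refine ⟨r ⁻¹' B, ⟨⟨B, hB, rfl⟩, hxB⟩, ?_⟩
    rintro _ ⟨⟨B', hB', rfl⟩, hxB'⟩
    show r ⁻¹' B' = r ⁻¹' B
    rw [hu B' ⟨hB', hxB'⟩]
  · rintro _ ⟨B, hB, rfl⟩ T hT T' hT'
    by_cases hsB : sX ∈ B
    · exact agree_change (hQP T hT) (hQP T' hT') (h3 T hT T' hT') hs (hsv B hsB) (hin B)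
        (hag' B hB T hT T' hT')
    · intro a ha b hb c hc e he
      exact hag' B hB T hT T' hT' a (hin B a ha (hno B hsB a ha)) b (hin B b hb (hno B hsB b hb))
        c (hin B c hc (hno B hsB c hc)) e (hin B e he (hno B hsB e he))
  · rintro _ ⟨B, hB, rfl⟩ _ ⟨B', hB', rfl⟩ hBB T hT
    have hne' : B ≠ B' := by rintro rfl; exact hBB rfl
    have key : ∀ B ∈ F, ∀ B' ∈ F, B ≠ B' → sX ∉ B' → ∀ a ∈ r ⁻¹' B, ∀ b ∈ r ⁻¹' B,
        ∀ c ∈ r ⁻¹' B', ∀ e ∈ r ⁻¹' B', ¬ Q T a b c e := by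
      intro B hB B' hB' hne' hsB'
      have base : ∀ a ∈ Subtype.val '' B, ∀ b ∈ Subtype.val '' B,
          ∀ c ∈ r ⁻¹' B', ∀ e ∈ r ⁻¹' B', ¬ Q T a b c e := by
        intro a ha b hb c hc e he
        exact hdis' B hB B' hB' hne' T hT a ha b hb c (hin B' c hc (hno B' hsB' c hc))
          e (hin B' e he (hno B' hsB' e he))
      by_cases hsB : sX ∈ B
      · exact disj_change (hQP T hT) hs (hsv B hsB) (hin B) (hno B' hsB') base
      · intro a ha b hb
        exact base a (hin B a ha (hno B hsB a ha)) b (hin B b hb (hno B hsB b hb))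
    by_cases hsB' : sX ∈ B'
    · have hsB : sX ∉ B := by
        intro hsB
        exact hne' ((huniq sX).unique ⟨hB, hsB⟩ ⟨hB', hsB'⟩)
      intro a ha b hb c hc e he
      rw [(hQP T hT).sw3]
      exact key B' hB' B hB hne'.symm hsB c hc e he a ha b hb
    · exact key B hB B' hB' hne' hsB'

lemma backward [Finite X] (𝒯 : Set (UTree X)) (S : Set X) (s : X) (hs : s ∈ S)
    (hQP : ∀ T ∈ 𝒯, QP (Q T) S)
    (h3 : ∀ T ∈ 𝒯, ∀ T' ∈ 𝒯, ∀ a b c e, a ∈ S → b ∈ S → c ∈ S → (Q T a b c e ↔ Q T' a b c e))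
    (𝒯S : Set (UTree ↥(Sᶜ ∪ {s} : Set X)))
    (hres : UTree.IsRestrictionFamily 𝒯 (Sᶜ ∪ {s}) 𝒯S)
    (F : Set (Set X)) (hF : UTree.IsAgreementForest 𝒯 F) :
    ∃ F', UTree.IsAgreementForest 𝒯S F' ∧ F'.ncard ≤ F.ncard := by
  classical
  rw [forest_iff] at hF
  obtain ⟨⟨hne, huniq⟩, hag, hdis⟩ := hF
  let C : Set ↥(Sᶜ ∪ {s} : Set X) := {x | ∃ B ∈ F, x.1 ∈ B ∧ (B ∩ S).Nonempty}
  let g : Set X → Set ↥(Sᶜ ∪ {s} : Set X) :=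
    fun B => if (B ∩ S).Nonempty then C else Subtype.val ⁻¹' B
  have g1 : ∀ B, (B ∩ S).Nonempty → g B = C := fun B h => if_pos h
  have g2 : ∀ B, ¬ (B ∩ S).Nonempty → g B = Subtype.val ⁻¹' B := fun B h => if_neg h
  have hno : ∀ B : Set X, ¬ (B ∩ S).Nonempty → ∀ x ∈ B, x ∉ S :=
    fun B h x hx hxS => h ⟨x, hx, hxS⟩
  have mixed : ∀ T ∈ 𝒯, ∃ B ∈ F, ∃ t ∈ S, t ∈ B ∧ ∀ x ∈ Subtype.val '' C, x ∉ S → x ∈ B := by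
    intro T hT
    by_cases hex : ∃ x ∈ C, x.1 ∉ S
    · obtain ⟨x, ⟨B, hB, hxB, t, htB, htS⟩, hxS⟩ := hex
      refine ⟨B, hB, t, htS, htB, ?_⟩
      rintro _ ⟨y, ⟨B', hB', hyB', t', htB', htS'⟩, rfl⟩ hyS
      by_contra hyB
      have hBB : B ≠ B' := by rintro rfl; exact hyB hyB'
      exact hdis B hB B' hB' hBB T hT t htB x hxB t' htB' y hyB'
        ((hQP T hT).p2 _ _ _ _ htS hxS htS' hyS)
    · obtain ⟨B, ⟨hB, hsB⟩, _⟩ := huniq s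
      refine ⟨B, hB, s, hs, hsB, ?_⟩
      rintro _ ⟨y, hy, rfl⟩ hyS
      exact absurd ⟨y, hy, hyS⟩ hex
  refine ⟨g '' F, ?_, Set.ncard_image_le (Set.toFinite _)⟩
  rw [forest_iff]
  refine ⟨⟨?_, ?_⟩, ?_, ?_⟩
  · rintro _ ⟨B, hB, rfl⟩
    by_cases hBS : (B ∩ S).Nonempty
    · rw [g1 B hBS]
      obtain ⟨B', ⟨hB', hsB'⟩, _⟩ := huniq s
      exact ⟨⟨s, Or.inr rfl⟩, B', hB', hsB', s, hsB', hs⟩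
    · rw [g2 B hBS]
      obtain ⟨x, hx⟩ := hne B hB
      exact ⟨⟨x, Or.inl (hno B hBS x hx)⟩, hx⟩
  · intro x
    obtain ⟨B, ⟨hB, hxB⟩, hu⟩ := huniq x.1
    refine ⟨g B, ⟨⟨B, hB, rfl⟩, ?_⟩, ?_⟩
    · by_cases hBS : (B ∩ S).Nonempty
      · rw [g1 B hBS]; exact ⟨B, hB, hxB, hBS⟩
      · rw [g2 B hBS]; exact hxB
    · rintro _ ⟨⟨B', hB', rfl⟩, hxB'⟩
      by_cases hBS : (B' ∩ S).Nonempty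
      · rw [g1 B' hBS] at hxB' ⊢
        obtain ⟨B2, hB2, hxB2, hBS2⟩ := hxB'
        rw [← hu B2 ⟨hB2, hxB2⟩, g1 B2 hBS2]
      · rw [g2 B' hBS] at hxB'
        rw [hu B' ⟨hB', hxB'⟩]
  · rintro _ ⟨B, hB, rfl⟩ R hR R' hR' a ha b hb c hc e he
    obtain ⟨T, hT, hRT⟩ := hres.1 R hR
    obtain ⟨T', hT', hRT'⟩ := hres.1 R' hR'
    rw [q_rest hRT, q_rest hRT']
    by_cases hBS : (B ∩ S).Nonempty
    · rw [g1 B hBS] at ha hb hc he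
      obtain ⟨B0, hB0, t, htS, htB, hall⟩ := mixed T hT
      exact agree_change (hQP T hT) (hQP T' hT') (h3 T hT T' hT') htS htB hall
        (hag B0 hB0 T hT T' hT') a ⟨a, ha, rfl⟩ b ⟨b, hb, rfl⟩ c ⟨c, hc, rfl⟩ e ⟨e, he, rfl⟩
    · rw [g2 B hBS] at ha hb hc he
      exact hag B hB T hT T' hT' a ha b hb c hc e he
  · rintro _ ⟨B, hB, rfl⟩ _ ⟨B', hB', rfl⟩ hBB R hR
    obtain ⟨T, hT, hRT⟩ := hres.1 R hR
    have hne' : B ≠ B' := by rintro rfl; exact hBB rfl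
    have key : ∀ B' ∈ F, ¬ (B' ∩ S).Nonempty → ∀ a ∈ C, ∀ b ∈ C, ∀ c ∈ B', ∀ e ∈ B',
        ¬ Q T a.1 b.1 c e := by
      intro B' hB' hBS' a ha b hb
      obtain ⟨B0, hB0, t, htS, htB, hall⟩ := mixed T hT
      have hn : B0 ≠ B' := by rintro rfl; exact hBS' ⟨t, htB, htS⟩
      exact disj_change (hQP T hT) htS htB hall (hno B' hBS')
        (hdis B0 hB0 B' hB' hn T hT) a ⟨a, ha, rfl⟩ b ⟨b, hb, rfl⟩
    intro a ha b hb c hc e he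
    rw [q_rest hRT]
    by_cases hBS : (B ∩ S).Nonempty <;> by_cases hBS' : (B' ∩ S).Nonempty
    · exact absurd ((g1 B hBS).trans (g1 B' hBS').symm) hBB
    · rw [g1 B hBS] at ha hb
      rw [g2 B' hBS'] at hc he
      exact key B' hB' hBS' a ha b hb c hc e he
    · rw [g2 B hBS] at ha hb
      rw [g1 B' hBS'] at hc he
      rw [(hQP T hT).sw3]
      exact key B hB hBS c hc e he a ha b hb
    · rw [g2 B hBS] at ha hb
      rw [g2 B' hBS'] at hc he
      exact hdis B hB B' hB' hne' T hT a ha b hb c hc e he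

end final

end STR

/-- **Lemma 2 (safeness of the subtree reduction).** If `S ⊆ X` induces a common pendant
subtree of `𝒯` and `𝒯_S` is the result of applying the subtree reduction rule (picking
`s ∈ S` and restricting every tree to `(X ∖ S) ∪ {s}`), then `𝒯_S` has an unrooted
agreement forest of size at most `k` iff `𝒯` has one of size at most `k`. -/
theorem subtree_reduction_safe (X : Type) [Finite X] (𝒯 : Set (UTree X))
    (S : Set X) (s : X) (hs : s ∈ S)
    (hS : UTree.InducesCommonPendant 𝒯 S)
    (𝒯S : Set (UTree ↥(Sᶜ ∪ {s} : Set X)))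
    (hres : UTree.IsRestrictionFamily 𝒯 (Sᶜ ∪ {s}) 𝒯S) (k : ℕ) :
    (∃ F, UTree.IsAgreementForest 𝒯S F ∧ F.ncard ≤ k) ↔
    (∃ F, UTree.IsAgreementForest 𝒯 F ∧ F.ncard ≤ k) := by
  have hP : ∀ T ∈ 𝒯, ∃ u v, STR.Pend T S u v := fun T hT => STR.pend_of T S (hS.2.1 T hT)
  have hQP : ∀ T ∈ 𝒯, STR.QP (STR.Q T) S := by
    intro T hT
    obtain ⟨u, v, hp⟩ := hP T hT
    exact STR.qp_of hp
  have h3 : ∀ T ∈ 𝒯, ∀ T' ∈ 𝒯, ∀ a b c e, a ∈ S → b ∈ S → c ∈ S →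
      (STR.Q T a b c e ↔ STR.Q T' a b c e) := by
    intro T hT T' hT' a b c e ha hb hc
    obtain ⟨u, v, hp⟩ := hP T hT
    obtain ⟨u', v', hp'⟩ := hP T' hT'
    exact STR.p3_of hp hp' (hS.2.2 T hT T' hT') e ha hb hc
  constructor
  · rintro ⟨F, hF, hk⟩
    obtain ⟨F', hF', hk'⟩ := STR.forward 𝒯 S s hs hQP h3 𝒯S hres F hF
    exact ⟨F', hF', hk'.trans hk⟩
  · rintro ⟨F, hF, hk⟩
    obtain ⟨F', hF', hk'⟩ := STR.backward 𝒯 S s hs hQP h3 𝒯S hres F hF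
    exact ⟨F', hF', hk'.trans hk⟩
end

section
/- Let 𝒯 be a set of unrooted binary phylogenetic trees on X, let C = (x_1,…,x_m) with m ≥ 2 be a common chain of 𝒯 (regarded as the set {x_1,…,x_m} ⊆ X), and let F be an unrooted agreement forest for 𝒯. Then F contains at most two inside-out blocks, i.e., at most two blocks B ∈ F with B ∩ C ≠ ∅ and B ⊄ C. -/
namespace UTree

variable {X : Type}

/-- Outgoing darts of a vertex set. -/
def outSet (T : UTree X) (S : Set T.V) : Set (T.V × T.V) :=
  {e | T.g.Adj e.1 e.2 ∧ e.1 ∈ S ∧ e.2 ∉ S}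

lemma exists_parent (T : UTree X) (x : X) :
    ∃ p, T.g.Adj (T.label x) p ∧ ∀ q, T.g.Adj (T.label x) q → q = p := by
  have h := (T.leaf_iff (T.label x)).2 ⟨x, rfl⟩
  obtain ⟨p, hp⟩ := Set.ncard_eq_one.1 h
  refine ⟨p, ?_, ?_⟩
  · have : p ∈ T.g.neighborSet (T.label x) := by rw [hp]; rfl
    exact this
  · intro q hq
    have : q ∈ T.g.neighborSet (T.label x) := hq
    rw [hp] at this
    exact this

lemma deg_le (T : UTree X) (v : T.V) : (T.g.neighborSet v).ncard ≤ 3 := by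
  by_cases h : v ∈ Set.range T.label
  · rw [(T.leaf_iff v).2 h]; norm_num
  · exact (T.internal_deg v h).le

lemma nbr_one (T : UTree X) (v a : T.V) (ha : T.g.Adj v a) :
    ∃ b c, ∀ w, T.g.Adj v w → w = a ∨ w = b ∨ w = c := by
  have := T.finV
  have h1 := Set.ncard_sdiff_singleton_add_one (s := T.g.neighborSet v) ha (Set.toFinite _)
  have h2 := T.deg_le v
  have h3 : (T.g.neighborSet v \ {a}).ncard ≤ 2 := by omega
  have h4 : ∃ b c, (T.g.neighborSet v \ {a}) ⊆ {b, c} := by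
    rcases Nat.lt_or_ge (T.g.neighborSet v \ {a}).ncard 2 with h | h
    · have h5 := Set.ncard_le_one_iff_subsingleton.1 (Nat.le_of_lt_succ h)
      by_cases he : (T.g.neighborSet v \ {a}).Nonempty
      · obtain ⟨b, hb⟩ := he
        exact ⟨b, b, fun w hw => Or.inl (h5 hw hb)⟩
      · refine ⟨a, a, fun w hw => (he ⟨w, hw⟩).elim⟩
    · obtain ⟨b, c, _, h⟩ := Set.ncard_eq_two.1 (le_antisymm h3 h)
      exact ⟨b, c, h.le⟩
  obtain ⟨b, c, h⟩ := h4
  refine ⟨b, c, fun w hw => ?_⟩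
  by_cases hwa : w = a
  · exact Or.inl hwa
  · exact Or.inr (h ⟨hw, hwa⟩)

lemma nbr_two (T : UTree X) (v a b : T.V) (ha : T.g.Adj v a) (hb : T.g.Adj v b) (hab : a ≠ b) :
    ∃ c, ∀ w, T.g.Adj v w → w = a ∨ w = b ∨ w = c := by
  obtain ⟨c, d, h⟩ := T.nbr_one v a ha
  rcases h b hb with h1 | h1 | h1
  · exact (hab h1.symm).elim
  · exact ⟨d, fun w hw => by rw [h1]; exact h w hw⟩
  · exact ⟨c, fun w hw => by rw [h1]; have := h w hw; tauto⟩

/-- The vertices of the chain and their parents have at most two outgoing darts. -/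
lemma out_le_two (T : UTree X) (x : ℕ → X) (p : ℕ → T.V) (n : ℕ)
    (hp : ∀ i, T.g.Adj (T.label (x i)) (p i))
    (hu : ∀ i q, T.g.Adj (T.label (x i)) q → q = p i)
    (hc : ∀ i < n, p i = p (i+1) ∨ T.g.Adj (p i) (p (i+1))) :
    ∃ a b, T.outSet {v | ∃ i ≤ n, v = T.label (x i) ∨ v = p i} ⊆ {a, b} := by
  induction n with
  | zero =>
    obtain ⟨b, c, h⟩ := T.nbr_one (p 0) _ (hp 0).symm
    refine ⟨(p 0, b), (p 0, c), ?_⟩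
    rintro ⟨u, v⟩ ⟨h1, ⟨i, hi, h2⟩, h3⟩
    simp only at h1 h2 h3
    obtain rfl : i = 0 := by omega
    have e1 : v ≠ T.label (x 0) := fun e => h3 ⟨0, le_rfl, Or.inl e⟩
    have e2 : v ≠ p 0 := fun e => h3 ⟨0, le_rfl, Or.inr e⟩
    rcases h2 with rfl | rfl
    · exact (e2 (hu _ _ h1)).elim
    · rcases h v h1 with r | r | r
      · exact (e1 r).elim
      · left; rw [r]
      · right; rw [r]; rfl
  | succ n ih =>
    obtain ⟨a, b, hab⟩ := ih (fun i hi => hc i (by omega))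
    by_cases hmem : p (n+1) ∈ {v | ∃ i ≤ n, v = T.label (x i) ∨ v = p i}
    · refine ⟨a, b, ?_⟩
      rintro ⟨u, v⟩ ⟨h1, ⟨i, hi, h2⟩, h3⟩
      apply hab
      simp only at h1 h2 h3
      have h4 : ¬ ∃ i ≤ n, v = T.label (x i) ∨ v = p i := by
        rintro ⟨j, hj, h⟩
        exact h3 ⟨j, by omega, h⟩
      refine ⟨h1, ?_, h4⟩
      rcases Nat.lt_or_ge n i with h | h
      · obtain rfl : i = n + 1 := by omega
        rcases h2 with rfl | rfl
        · exact (h3 ⟨n+1, le_rfl, Or.inr (hu _ _ h1)⟩).elim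
        · exact hmem
      · exact ⟨i, h, h2⟩
    · have hadj : T.g.Adj (p n) (p (n+1)) := by
        rcases hc n (by omega) with h | h
        · exact (hmem ⟨n, le_rfl, Or.inr h.symm⟩).elim
        · exact h
      have hne : T.label (x (n+1)) ≠ p n := by
        intro h
        have h1 := hp n
        rw [← h] at h1
        exact hmem ⟨n, le_rfl, Or.inl (hu _ _ h1.symm).symm⟩
      obtain ⟨c, hcc⟩ := T.nbr_two (p (n+1)) _ _ (hp (n+1)).symm hadj.symm hne
      have hin : (p n, p (n+1)) ∈ T.outSet {v | ∃ i ≤ n, v = T.label (x i) ∨ v = p i} :=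
        ⟨hadj, ⟨n, le_rfl, Or.inr rfl⟩, hmem⟩
      have hd : ∃ d, T.outSet {v | ∃ i ≤ n, v = T.label (x i) ∨ v = p i} ⊆
          {(p n, p (n+1)), d} := by
        rcases hab hin with h | h
        · exact ⟨b, by rw [h]; exact hab⟩
        · refine ⟨a, ?_⟩
          rw [Set.mem_singleton_iff.1 h, Set.pair_comm]; exact hab
      obtain ⟨d, hd⟩ := hd
      refine ⟨d, (p (n+1), c), ?_⟩
      rintro ⟨u, v⟩ ⟨h1, ⟨i, hi, h2⟩, h3⟩
      simp only at h1 h2 h3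
      have h4 : ¬ ∃ i ≤ n, v = T.label (x i) ∨ v = p i := by
        rintro ⟨j, hj, h⟩
        exact h3 ⟨j, by omega, h⟩
      have e1 : v ≠ T.label (x (n+1)) := fun e => h3 ⟨n+1, le_rfl, Or.inl e⟩
      have e2 : v ≠ p (n+1) := fun e => h3 ⟨n+1, le_rfl, Or.inr e⟩
      rcases Nat.lt_or_ge n i with h | h
      · obtain rfl : i = n + 1 := by omega
        rcases h2 with rfl | rfl
        · exact (e2 (hu _ _ h1)).elim
        · rcases hcc v h1 with r | r | r
          · exact (e1 r).elim
          · exact (h4 ⟨n, le_rfl, Or.inr r⟩).elim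
          · right; rw [r]; rfl
      · have hm : (u, v) ∈ T.outSet {v | ∃ i ≤ n, v = T.label (x i) ∨ v = p i} :=
          ⟨h1, ⟨i, h, h2⟩, h4⟩
        rcases hd hm with r | r
        · exact (e2 (Prod.ext_iff.1 r).2).elim
        · left; exact r

/-- Two consecutive chain elements `a`, `b`: the parent of `a` is not a leaf outside. -/
lemma parent_ne (T : UTree X) (a b y : X) (p q : T.V) (hab : a ≠ b) (hyb : y ≠ b)
    (hp : T.g.Adj (T.label a) p) (hq : T.g.Adj (T.label b) q)
    (h : p = q ∨ T.g.Adj p q) : T.label y ≠ p := by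
  rintro rfl
  obtain ⟨r, _, hr⟩ := T.exists_parent y
  obtain ⟨s, _, hs⟩ := T.exists_parent a
  have h1 := hr _ hp.symm
  rcases h with h | h
  · rw [← h] at hq
    exact hab (T.label_inj (h1.trans (hr _ hq.symm).symm))
  · have h2 := hr _ h
    have h3 : q = T.label a := h2.trans h1.symm
    rw [h3] at hq
    exact hyb (T.label_inj ((hs _ hp).trans (hs _ hq.symm).symm))

end UTree

theorem at_most_two_inside_out_blocks (X : Type) [Finite X] (𝒯 : Set (UTree X))
    (h𝒯 : 𝒯.Nonempty) (F : Set (Set X)) (hF : UTree.IsAgreementForest 𝒯 F)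
    (m : ℕ) (x : Fin m → X) (hx : UTree.IsCommonChain 𝒯 x)
    (C : Set X) (hC : C = Set.range x) :
    {B | B ∈ F ∧ (B ∩ C).Nonempty ∧ ¬ B ⊆ C}.ncard ≤ 2 := by
  obtain ⟨T, hT⟩ := h𝒯
  obtain ⟨hm, hinj, hch⟩ := hx
  have hch := hch T hT
  choose par hpar hparu using fun y : X => T.exists_parent y
  let x' : ℕ → X := fun i => if h : i < m then x ⟨i, h⟩ else x ⟨0, by omega⟩
  have hx' : ∀ i (h : i < m), x' i = x ⟨i, h⟩ := fun i h => dif_pos h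
  have hc : ∀ i < m - 1, par (x' i) = par (x' (i+1)) ∨
      T.g.Adj (par (x' i)) (par (x' (i+1))) := by
    intro i hi
    rw [hx' i (by omega), hx' (i+1) (by omega)]
    exact hch i (by omega) _ _ (hpar _) (hpar _)
  have hne : ∀ i j, i < m → j < m → i ≠ j → x' i ≠ x' j := by
    intro i j hi hj hij h
    rw [hx' i hi, hx' j hj] at h
    have := hinj h
    simp only [Fin.mk.injEq] at this
    exact hij this
  have hxC : ∀ i < m, x' i ∈ C := fun i hi => by rw [hx' i hi, hC]; exact ⟨_, rfl⟩
  obtain ⟨a, b, hab⟩ := T.out_le_two x' (fun i => par (x' i)) (m-1) (fun i => hpar _)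
    (fun i => hparu _) hc
  set S : Set T.V := {v | ∃ i ≤ m-1, v = T.label (x' i) ∨ v = par (x' i)} with hS
  have hout : ∀ y, y ∉ C → T.label y ∉ S := by
    rintro y hy ⟨i, hi, h | h⟩
    · exact hy (T.label_inj h ▸ hxC i (by omega))
    · have hyj : ∀ j < m, y ≠ x' j := fun j hj e => hy (e ▸ hxC j hj)
      by_cases hi' : i + 1 < m
      · exact T.parent_ne (x' i) (x' (i+1)) y _ _ (hne _ _ (by omega) hi' (by omega))
          (hyj _ hi') (hpar _) (hpar _) (hc i (by omega)) h
      · obtain ⟨j, rfl⟩ : ∃ j, i = j + 1 := ⟨i - 1, by omega⟩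
        refine T.parent_ne (x' (j+1)) (x' j) y _ _ (hne _ _ (by omega) (by omega) (by omega))
          (hyj _ (by omega)) (hpar _) (hpar _) ?_ h
        rcases hc j (by omega) with h | h
        · exact Or.inl h.symm
        · exact Or.inr h.symm
  have key : ∀ B : Set X, ∃ e : T.V × T.V, (B ∩ C).Nonempty ∧ ¬ B ⊆ C →
      e ∈ T.outSet S ∧ e.1 ∈ T.spanSet B := by
    intro B
    by_cases hB : (B ∩ C).Nonempty ∧ ¬ B ⊆ C
    · obtain ⟨⟨z, hzB, hzC⟩, hn⟩ := hB
      obtain ⟨y, hyB, hyC⟩ := Set.not_subset.1 hn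
      obtain ⟨w, hw⟩ := (T.isTree.connected.preconnected (T.label z) (T.label y)).exists_isPath
      have hz : T.label z ∈ S := by
        rw [hC] at hzC
        obtain ⟨i, rfl⟩ := hzC
        exact ⟨i, by omega, Or.inl (by rw [hx' i i.2])⟩
      obtain ⟨d, hd, h1, h2⟩ := w.exists_boundary_dart S hz (hout y hyC)
      exact ⟨(d.fst, d.snd), fun _ => ⟨⟨d.adj, h1, h2⟩,
        ⟨z, hzB, y, hyB, w, hw, w.dart_fst_mem_support_of_mem_darts hd⟩⟩⟩
    · exact ⟨a, fun h => (hB h).elim⟩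
  choose f hf using key
  refine le_trans (Set.ncard_le_ncard_of_injOn (t := {a, b}) f ?_ ?_ (Set.toFinite _))
    ((Set.ncard_insert_le a {b}).trans (by rw [Set.ncard_singleton]))
  · rintro B ⟨_, hB⟩
    exact hab (hf B hB).1
  · rintro B ⟨hBF, hB⟩ B' ⟨hBF', hB'⟩ he
    by_contra hcon
    have hd := hF.2.2 B hBF B' hBF' hcon T hT
    refine Set.disjoint_left.1 hd (hf B hB).2 ?_
    rw [he]
    exact (hf B' hB').2
end

section
/- Let 𝒯 be a set of unrooted binary phylogenetic trees on X and let F be an unrooted agreement forest for 𝒯 of size k. Then for every T ∈ 𝒯, Σ_{B ∈ F} deg^T(B) ≤ 2k − 2. -/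
open Finset in
/-- `T[B]` is connected. -/
theorem UTree.induce_spanSet_connected {X : Type} (T : UTree X) (B : Set X) (hB : B.Nonempty) :
    (T.g.induce (T.spanSet B)).Connected := by
  classical
  obtain ⟨x0, hx0⟩ := hB
  have key : ∀ x ∈ B, ∀ y ∈ B, ∀ p : T.g.Walk (T.label x) (T.label y), p.IsPath →
      {v | v ∈ p.support} ⊆ T.spanSet B := fun x hx y hy p hp v hv => ⟨x, hx, y, hy, p, hp, hv⟩
  refine SimpleGraph.induce_connected_of_patches (T.label x0)
    ⟨x0, hx0, x0, hx0, SimpleGraph.Walk.nil, by simp, by simp⟩ ?_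
  rintro v ⟨x, hx, y, hy, p, hp, hv⟩
  obtain ⟨q, hq⟩ := (T.isTree.1.preconnected (T.label x0) (T.label x)).exists_isPath
  have hx1 : T.label x ∈ {v | v ∈ q.support} := by simp
  have hx2 : T.label x ∈ {v | v ∈ p.support} := by simp
  have hu := SimpleGraph.induce_union_connected (q.connected_induce_support).preconnected
    (p.connected_induce_support).preconnected ⟨_, hx1, hx2⟩
  exact ⟨_, Set.union_subset (key _ hx0 _ hx q hq) (key _ hx _ hy p hp),
    Or.inl (by simp), Or.inr hv, hu.preconnected _ _⟩

open Finset in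
/-- Degree count for one block. -/
theorem UTree.blockDeg_le {X : Type} (T : UTree X) [Fintype T.V] [DecidableEq T.V]
    [DecidableRel T.g.Adj] (B : Set X) (hB : B.Nonempty) (S : Finset T.V)
    (hS : (S : Set T.V) = T.spanSet B) :
    (T.blockDeg B : ℤ) ≤ 2 + ∑ u ∈ S, ((T.g.degree u : ℤ) - 2) := by
  classical
  have hc := T.induce_spanSet_connected B hB
  rw [← hS] at hc
  have h1 : T.blockDeg B ≤ ∑ u ∈ S, #(T.g.neighborFinset u \ S) := by
    have : {e : Sym2 T.V | ∃ u v : T.V, T.g.Adj u v ∧ e = s(u, v) ∧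
        u ∈ T.spanSet B ∧ v ∉ T.spanSet B} =
        ((S.biUnion fun u => (T.g.neighborFinset u \ S).image fun v => s(u, v) :
          Finset (Sym2 T.V)) : Set (Sym2 T.V)) := by
      ext e
      simp only [← hS, Set.mem_ofPred_eq, coe_biUnion, Set.mem_iUnion, mem_coe, mem_image,
        mem_sdiff, SimpleGraph.mem_neighborFinset]
      constructor
      · rintro ⟨u, v, h, rfl, hu, hv⟩
        exact ⟨u, hu, v, ⟨h, hv⟩, rfl⟩
      · rintro ⟨u, hu, v, ⟨h, hv⟩, rfl⟩
        exact ⟨u, v, h, rfl, hu, hv⟩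
    rw [UTree.blockDeg, this, Set.ncard_coe_finset]
    exact card_biUnion_le.trans (sum_le_sum fun u _ => card_image_le)
  have h2 : 2 * #S ≤ ∑ u ∈ S, #(T.g.neighborFinset u ∩ S) + 2 := by
    have e1 := (T.g.induce (S : Set T.V)).sum_degrees_eq_twice_card_edges
    have e2 := hc.card_vert_le_card_edgeSet_add_one
    have e3 : ∀ u : (S : Set T.V), (T.g.induce (S : Set T.V)).degree u
        = #(T.g.neighborFinset u ∩ S) := by
      intro u
      rw [← SimpleGraph.card_neighborFinset_eq_degree, ← card_map (Function.Embedding.subtype (· ∈ (S : Set T.V)))]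
      congr 1
      ext w
      simp
    simp only [e3] at e1
    rw [Nat.card_eq_fintype_card, Nat.card_eq_fintype_card,
      ← SimpleGraph.edgeFinset_card] at e2
    have e4 : ∑ u : (S : Set T.V), #(T.g.neighborFinset u ∩ S)
        = ∑ u ∈ S, #(T.g.neighborFinset u ∩ S) :=
      Finset.sum_coe_sort S fun u => #(T.g.neighborFinset u ∩ S)
    have e5 : Fintype.card (S : Set T.V) = #S := by simp
    omega
  have h3 : ∑ u ∈ S, T.g.degree u
      = ∑ u ∈ S, #(T.g.neighborFinset u \ S) + ∑ u ∈ S, #(T.g.neighborFinset u ∩ S) := by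
    rw [← sum_add_distrib]
    refine sum_congr rfl fun u _ => ?_
    rw [card_sdiff_add_card_inter, SimpleGraph.card_neighborFinset_eq_degree]
  rw [sum_sub_distrib, sum_const, ← Nat.cast_sum]
  simp only [nsmul_eq_mul]
  omega

/-- **Lemma 5 (degree bound).** If `F` is an unrooted agreement forest of size `k` for a
set `𝒯` of unrooted binary phylogenetic trees on `X`, then for every tree `T ∈ 𝒯` the
sum of the degrees of the blocks satisfies `Σ_{B ∈ F} deg^T(B) ≤ 2k − 2`. -/
theorem degree_bound (X : Type) [Finite X] (𝒯 : Set (UTree X))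
    (F : Set (Set X)) (k : ℕ)
    (hF : UTree.IsAgreementForest 𝒯 F) (hFk : F.ncard = k) :
    ∀ T ∈ 𝒯, (∑ᶠ B ∈ F, (UTree.blockDeg T B : ℤ)) ≤ 2 * k - 2 := by
  classical
  intro T hT
  obtain ⟨⟨hne, hpart⟩, -, hdisj⟩ := hF
  have := T.finV
  have := Fintype.ofFinite T.V
  have hFf : F.Finite := Set.toFinite F
  let S : Set X → Finset T.V := fun B => (T.spanSet B).toFinset
  have hS : ∀ B, (S B : Set T.V) = T.spanSet B := fun B => by simp [S]
  rw [finsum_mem_eq_finite_toFinset_sum _ hFf]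
  have hk : hFf.toFinset.card = k := by rw [← hFk, Set.ncard_eq_toFinset_card F hFf]
  have hpd : (hFf.toFinset : Set (Set X)).PairwiseDisjoint S := by
    intro B hB B' hB' h
    have hd := hdisj B (by simpa using hB) B' (by simpa using hB') h T hT
    rw [← hS, ← hS] at hd
    exact Finset.disjoint_coe.1 hd
  have hle : ∑ B ∈ hFf.toFinset, (T.blockDeg B : ℤ)
      ≤ ∑ B ∈ hFf.toFinset, (2 + ∑ u ∈ S B, ((T.g.degree u : ℤ) - 2)) :=
    Finset.sum_le_sum fun B hB =>
      T.blockDeg_le B (hne B (by simpa using hB)) (S B) (hS B)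
  rw [Finset.sum_add_distrib, ← Finset.sum_biUnion hpd, Finset.sum_const, hk] at hle
  have hall : ∑ u ∈ hFf.toFinset.biUnion S, ((T.g.degree u : ℤ) - 2)
      ≤ ∑ u, ((T.g.degree u : ℤ) - 2) := by
    refine Finset.sum_le_sum_of_subset_of_nonneg (Finset.subset_univ _) ?_
    intro u _ hu
    have hul : u ∉ Set.range T.label := by
      rintro ⟨x, rfl⟩
      obtain ⟨B, ⟨hB, hx⟩, -⟩ := hpart x
      refine hu (Finset.mem_biUnion.2 ⟨B, by simpa using hB, ?_⟩)
      rw [← Finset.mem_coe, hS]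
      exact ⟨x, hx, x, hx, SimpleGraph.Walk.nil, by simp, by simp⟩
    have h3 := T.internal_deg u hul
    rw [Set.ncard_eq_toFinset_card', ← SimpleGraph.neighborFinset_def,
      SimpleGraph.card_neighborFinset_eq_degree] at h3
    omega
  have htot := T.g.sum_degrees_eq_twice_card_edges
  have hE := T.isTree.card_edgeFinset
  have hV : ∑ u, ((T.g.degree u : ℤ) - 2) = -2 := by
    rw [Finset.sum_sub_distrib, Finset.sum_const, ← Nat.cast_sum, htot, Finset.card_univ, ← hE]
    simp only [nsmul_eq_mul]
    push_cast
    ring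
  simp only [nsmul_eq_mul] at hle
  linarith
end
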